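/- Let n ≥ 1 and let Sⁿ denote the unit sphere in ℝ^{n+1}. Let X and Y be flat S-carpets in Sⁿ and let h be a homeomorphism from the subspace X onto the subspace Y. Then there is a self-homeomorphism H of Sⁿ such that H x = h x for all x ∈ X. -/

import Mathlib

/-- The set of connected components of the complement of `A` in `M`. -/
def complComponents {M : Type*} [TopologicalSpace M] (A : Set M) : Set (Set M) :=
  {U | ∃ p ∈ Aᶜ, U = connectedComponentIn Aᶜ p}

/-- `A` is a flat S-carpet of dimension `n` in the space `M`. -/
def IsFlatSCarpet (n : ℕ) {M : Type*} [TopologicalSpace M] (A : Set M) : Prop :=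
  -- (1) closed, nowhere dense, connected
  IsClosed A ∧ IsNowhereDense A ∧ IsConnected A ∧
  -- (2) countably many components, each open
  (complComponents A).Countable ∧ (∀ U ∈ complComponents A, IsOpen U) ∧
  -- (3) closures of distinct components are pairwise disjoint
  (∀ U ∈ complComponents A, ∀ V ∈ complComponents A, U ≠ V →
    Disjoint (closure U) (closure V)) ∧
  -- (4) each component is flat: some open neighborhood of its closure is
  -- homeomorphic to ℝⁿ via a map carrying the component onto the unit ball
  (∀ U ∈ complComponents A, ∃ V : Set M, IsOpen V ∧ closure U ⊆ V ∧
    ∃ φ : ↥V ≃ₜ EuclideanSpace ℝ (Fin n),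
      φ '' {x : ↥V | (x : M) ∈ U} = Metric.ball 0 1) ∧
  -- (5) null sequences of components
  (∀ U : ℕ → Set M, (∀ k, U k ∈ complComponents A) → Function.Injective U →
    ∀ x : ℕ → M, (∀ k, x k ∈ closure (U k)) →
      ∀ p : M, Filter.Tendsto x Filter.atTop (nhds p) →
        ∀ W : Set M, IsOpen W → p ∈ W →
          ∀ᶠ k in Filter.atTop, closure (U k) ⊆ W)

section Brouwer

open Metric Set MeasureTheory

variable {E : Type*} [NormedAddCommGroup E] [InnerProductSpace ℝ E] [FiniteDimensional ℝ E]

/-- `t ↦ det (1 + t A)` is a polynomial of degree at most the dimension. -/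
theorem exists_polynomial_eval_eq_det_one_add_smul (A : E →L[ℝ] E) :
    ∃ p : Polynomial ℝ, p.natDegree ≤ Module.finrank ℝ E ∧
      ∀ t : ℝ, p.eval t = (ContinuousLinearMap.id ℝ E + t • A).det := by
  classical
  let b := Module.finBasis ℝ E
  let M := LinearMap.toMatrix b b (A : E →ₗ[ℝ] E)
  refine ⟨Matrix.det ((Polynomial.X : Polynomial ℝ) • M.map Polynomial.C +
    (1 : Matrix _ _ ℝ).map Polynomial.C), ?_, fun t => ?_⟩
  · simpa using Polynomial.natDegree_det_X_add_C_le M 1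
  · have h1 : (ContinuousLinearMap.id ℝ E + t • A).det
        = (LinearMap.toMatrix b b
          ((ContinuousLinearMap.id ℝ E + t • A : E →L[ℝ] E) : E →ₗ[ℝ] E)).det := by
      rw [LinearMap.det_toMatrix]
    have h2 : LinearMap.toMatrix b b
        ((ContinuousLinearMap.id ℝ E + t • A : E →L[ℝ] E) : E →ₗ[ℝ] E) = 1 + t • M := by
      simp [M]
    rw [h1, h2, ← Polynomial.coe_evalRingHom, RingHom.map_det]
    congr 1
    ext i j
    by_cases hij : i = j <;> simp [hij] <;> ring

/-- The closed unit ball does not retract onto its boundary by a `C¹` map. -/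
theorem not_exists_contDiff_retraction [Nontrivial E] {r : E → E}
    (hr : ∀ x ∈ closedBall (0 : E) 1, ContDiffAt ℝ 1 r x)
    (hr1 : ∀ x ∈ closedBall (0 : E) 1, ‖r x‖ = 1)
    (hrs : ∀ x ∈ sphere (0 : E) 1, r x = x) : False := by
  classical
  borelize E
  let g : E → E := fun x => if x ∈ closedBall (0 : E) 1 then r x - x else 0
  obtain ⟨K, hK⟩ : ∃ K, LipschitzOnWith K (fun x => r x - x) (closedBall (0 : E) 1) :=
    ContDiffOn.exists_lipschitzOnWith (n := 1)
      (fun x hx => ((hr x hx).sub contDiffAt_id).contDiffWithinAt) one_ne_zero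
      (convex_closedBall _ _) (isCompact_closedBall _ _)
  have hgb : ∀ x ∈ closedBall (0 : E) 1, ‖r x - x‖ ≤ K * (1 - ‖x‖) := by
    intro x hx
    obtain ⟨e, he, hxe⟩ : ∃ e : E, ‖e‖ = 1 ∧ x = ‖x‖ • e := by
      by_cases hx0 : x = 0
      · obtain ⟨e, he⟩ := exists_norm_eq E zero_le_one
        exact ⟨e, he, by simp [hx0]⟩
      · exact ⟨‖x‖⁻¹ • x, norm_smul_inv_norm (𝕜 := ℝ) hx0, by
          rw [smul_smul, mul_inv_cancel₀ (norm_ne_zero_iff.2 hx0), one_smul]⟩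
    have h1 := hK.dist_le_mul x hx e (by simp [he])
    have hx' : ‖x‖ ≤ 1 := by simpa using hx
    have h2 : dist x e = 1 - ‖x‖ := by
      have : x - e = -((1 - ‖x‖) • e) := by rw [sub_smul, one_smul, ← hxe]; abel
      rw [dist_eq_norm, this, norm_neg, norm_smul, he, mul_one, Real.norm_of_nonneg (by linarith)]
    rw [h2, hrs e (by simp [he]), sub_self, dist_zero_right] at h1
    exact h1
  have hg : LipschitzWith K g := by
    have key : ∀ x ∈ closedBall (0 : E) 1, ∀ y ∉ closedBall (0 : E) 1,
        ‖r x - x‖ ≤ K * dist x y := by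
      intro x hx y hy
      refine (hgb x hx).trans (mul_le_mul_of_nonneg_left ?_ K.2)
      have : 1 < ‖y‖ := by simpa using hy
      have := norm_sub_norm_le y x
      rw [dist_comm, dist_eq_norm]; linarith
    refine LipschitzWith.of_dist_le_mul fun x y => ?_
    by_cases hx : x ∈ closedBall (0 : E) 1 <;> by_cases hy : y ∈ closedBall (0 : E) 1
    · simp only [g, if_pos hx, if_pos hy]; exact hK.dist_le_mul x hx y hy
    · simp only [g, if_pos hx, if_neg hy, dist_zero_right]; exact key x hx y hy
    · simp only [g, if_neg hx, if_pos hy, dist_zero_left]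
      rw [dist_comm]; exact key y hy x hx
    · simp only [g, if_neg hx, if_neg hy, dist_self]; positivity
  let A : E → (E →L[ℝ] E) := fun x => fderiv ℝ r x - ContinuousLinearMap.id ℝ E
  have hgA : ∀ x ∈ ball (0 : E) 1, HasFDerivAt g (A x) x := by
    intro x hx
    have : HasFDerivAt (fun x => r x - x) (A x) x :=
      (((hr x (ball_subset_closedBall hx)).differentiableAt one_ne_zero).hasFDerivAt).sub
        (hasFDerivAt_id x)
    refine this.congr_of_eventuallyEq ?_
    filter_upwards [isOpen_ball.mem_nhds hx] with y hy
    simp only [g, if_pos (ball_subset_closedBall hy)]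
  have hAK : ∀ x ∈ ball (0 : E) 1, ‖A x‖ ≤ K := fun x hx =>
    (hgA x hx).le_of_lipschitz hg
  -- the perturbed identity
  let F : ℝ → E → E := fun t x => x + t • g x
  have hsmall : ∀ t : ℝ, 0 ≤ t → t * K < 1 → Function.Injective (F t) ∧
      F t '' ball (0 : E) 1 = ball (0 : E) 1 := by
    intro t ht htK
    have happ : ApproximatesLinearOn (F t)
        ((ContinuousLinearEquiv.refl ℝ E : E ≃L[ℝ] E) : E →L[ℝ] E) univ
        (t.toNNReal * K) := by
      intro x _ y _
      have : F t x - F t y - ((ContinuousLinearEquiv.refl ℝ E : E ≃L[ℝ] E) : E →L[ℝ] E) (x - y)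
          = t • (g x - g y) := by
        simp only [F, ContinuousLinearEquiv.coe_coe, ContinuousLinearEquiv.refl_apply, smul_sub]
        abel
      rw [this, norm_smul, Real.norm_of_nonneg ht, NNReal.coe_mul, Real.coe_toNNReal t ht,
        mul_assoc]
      refine mul_le_mul_of_nonneg_left ?_ ht
      simpa [dist_eq_norm] using hg.dist_le_mul x y
    have hc : Subsingleton E ∨ (t.toNNReal * K : NNReal) <
        ‖((ContinuousLinearEquiv.refl ℝ E).symm : E →L[ℝ] E)‖₊⁻¹ := by
      right
      have : ‖((ContinuousLinearEquiv.refl ℝ E).symm : E →L[ℝ] E)‖₊ = 1 := by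
        simp
      rw [this, inv_one]
      rw [← NNReal.coe_lt_coe, NNReal.coe_mul, Real.coe_toNNReal t ht]
      exact htK
    let e := happ.toHomeomorph (F t) hc
    have he : ∀ x, e x = F t x := fun x => rfl
    have hinj : Function.Injective (F t) := fun x y hxy => e.injective (by rw [he, he, hxy])
    have hout : ∀ x ∉ ball (0 : E) 1, F t x = x := by
      intro x hx
      have hx1 : 1 ≤ ‖x‖ := by simpa using hx
      have : g x = 0 := by
        by_cases hxc : x ∈ closedBall (0 : E) 1
        · simp only [g, if_pos hxc]
          rw [hrs x ?_, sub_self]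
          have : ‖x‖ ≤ 1 := by simpa using hxc
          simpa using le_antisymm this hx1
        · simp only [g, if_neg hxc]
      simp [F, this]
    refine ⟨hinj, ?_⟩
    apply Subset.antisymm
    · rintro _ ⟨x, hx, rfl⟩
      by_contra hcon
      have := hinj (hout _ hcon)
      rw [this] at hcon
      exact hcon hx
    · intro y hy
      obtain ⟨x, hx⟩ := e.surjective y
      rw [he] at hx
      refine ⟨x, ?_, hx⟩
      by_contra hcon
      rw [hout x hcon] at hx
      exact hcon (hx ▸ hy)
  let D : ℝ → E → ℝ := fun t x => (ContinuousLinearMap.id ℝ E + t • A x).det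
  choose P hPdeg hPeval using fun x => exists_polynomial_eval_eq_det_one_add_smul (A x)
  have hFD : ∀ t, ∀ x ∈ ball (0 : E) 1,
      HasFDerivAt (F t) (ContinuousLinearMap.id ℝ E + t • A x) x := fun t x hx =>
    (hasFDerivAt_id x).add ((hgA x hx).const_smul t)
  have hDpos : ∀ t : ℝ, 0 ≤ t → t * K < 1 → ∀ x ∈ ball (0 : E) 1, 0 < D t x := by
    intro t ht htK x hx
    have hne : ∀ s ∈ Icc 0 t, D s x ≠ 0 := by
      intro s hs h0
      have hu : IsUnit (1 - (-(s • A x)) : E →L[ℝ] E) := by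
        apply isUnit_one_sub_of_norm_lt_one
        rw [norm_neg, norm_smul, Real.norm_of_nonneg hs.1]
        calc s * ‖A x‖ ≤ t * K := mul_le_mul hs.2 (hAK x hx) (norm_nonneg _) ht
          _ < 1 := htK
      rw [sub_neg_eq_add] at hu
      have := (hu.map (ContinuousLinearMap.toLinearMapRingHom :
        (E →L[ℝ] E) →+* (E →ₗ[ℝ] E))).map (LinearMap.det : (E →ₗ[ℝ] E) →* ℝ)
      exact this.ne_zero h0
    have hcont : Continuous fun s => D s x := by
      have : (fun s => D s x) = fun s => (P x).eval s := funext fun s => (hPeval x s).symm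
      rw [this]; exact (P x).continuous
    have h0 : D 0 x = 1 := by
      simp only [D, zero_smul, add_zero]
      exact LinearMap.det_id
    by_contra hcon
    push Not at hcon
    obtain ⟨s, hs, hs0⟩ := intermediate_value_Icc' ht hcont.continuousOn
      (show (0 : ℝ) ∈ Icc (D t x) (D 0 x) from ⟨hcon, by rw [h0]; exact zero_le_one⟩)
    exact hne s hs hs0
  have hlint : ∀ t : ℝ, 0 ≤ t → t * K < 1 →
      (∫⁻ x in ball (0 : E) 1, ENNReal.ofReal |D t x|) = volume (ball (0 : E) 1) := by
    intro t ht htK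
    have := lintegral_abs_det_fderiv_eq_addHaar_image volume
      (measurableSet_ball (x := (0 : E)) (ε := 1))
      (fun x hx => (hFD t x hx).hasFDerivWithinAt) ((hsmall t ht htK).1.injOn)
    rw [(hsmall t ht htK).2] at this
    exact this
  have hmeas : ∀ t, AEStronglyMeasurable (D t) (volume.restrict (ball (0 : E) 1)) := by
    intro t
    refine ContinuousOn.aestronglyMeasurable ?_ measurableSet_ball
    intro x hx
    have h1 : ContinuousAt (fun x => fderiv ℝ r x) x :=
      (hr x (ball_subset_closedBall hx)).continuousAt_fderiv one_ne_zero
    have h2 : ContinuousAt (fun x => ContinuousLinearMap.id ℝ E + t • A x) x :=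
      continuousAt_const.add ((h1.sub continuousAt_const).const_smul t)
    exact (ContinuousLinearMap.continuous_det.continuousAt.comp h2).continuousWithinAt
  have hvol : volume (ball (0 : E) 1) ≠ ⊤ := measure_ball_lt_top.ne
  have hint : ∀ t : ℝ, 0 ≤ t → t * K < 1 → IntegrableOn (D t) (ball (0 : E) 1) := by
    intro t ht htK
    refine ⟨hmeas t, ?_⟩
    have := hlint t ht htK
    rw [hasFiniteIntegral_iff_norm]
    simp only [Real.norm_eq_abs]
    rw [this]; exact hvol.lt_top
  have hintegral : ∀ t : ℝ, 0 ≤ t → t * K < 1 →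
      ∫ x in ball (0 : E) 1, D t x = volume.real (ball (0 : E) 1) := by
    intro t ht htK
    rw [integral_eq_lintegral_of_nonneg_ae _ (hmeas t), Measure.real, ← hlint t ht htK]
    · congr 1
      refine setLIntegral_congr_fun measurableSet_ball fun x hx => ?_
      simp only [abs_of_pos (hDpos t ht htK x hx)]
    · filter_upwards [ae_restrict_mem measurableSet_ball] with x hx
      exact (hDpos t ht htK x hx).le
  -- the determinant vanishes at time one
  have hD1 : ∀ x ∈ ball (0 : E) 1, D 1 x = 0 := by
    intro x hx
    have hid : ContinuousLinearMap.id ℝ E + (1 : ℝ) • A x = fderiv ℝ r x := by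
      simp [A]
    have hrd : HasFDerivAt r (fderiv ℝ r x) x :=
      ((hr x (ball_subset_closedBall hx)).differentiableAt one_ne_zero).hasFDerivAt
    have horth : ∀ v, inner ℝ (r x) (fderiv ℝ r x v) = 0 := by
      intro v
      have h1 := hrd.norm_sq
      have h2 : HasFDerivAt (fun y => ‖r y‖ ^ 2) (0 : E →L[ℝ] ℝ) x := by
        refine (hasFDerivAt_const (1 : ℝ) x).congr_of_eventuallyEq ?_
        filter_upwards [isOpen_ball.mem_nhds hx] with y hy
        rw [hr1 y (ball_subset_closedBall hy), one_pow]
      have h3 := congrArg (fun L : E →L[ℝ] ℝ => L v) (h1.unique h2)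
      simpa using h3
    by_contra hne
    simp only [D] at hne
    rw [hid] at hne
    have hsurj : Function.Surjective (fderiv ℝ r x) := by
      let e := LinearMap.equivOfDetNeZero ((fderiv ℝ r x : E →L[ℝ] E) : E →ₗ[ℝ] E) hne
      intro y
      obtain ⟨z, hz⟩ := e.surjective y
      exact ⟨z, hz⟩
    obtain ⟨v, hv⟩ := hsurj (r x)
    have := horth v
    rw [hv, real_inner_self_eq_norm_sq, hr1 x (ball_subset_closedBall hx)] at this
    norm_num at this
  -- interpolate
  let d := Module.finrank ℝ E
  let c : ℝ := 1 / ((K + 1) * (d + 1))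
  have hc : 0 < c := by positivity
  let v : ℕ → ℝ := fun i => c * i
  let s := Finset.range (d + 1)
  have hv0 : ∀ i, 0 ≤ v i := fun i => by positivity
  have hvK : ∀ i ∈ s, v i * K < 1 := by
    intro i hi
    have hi' : (i : ℝ) < d + 1 := by exact_mod_cast Finset.mem_range.1 hi
    have hK0 : (0 : ℝ) ≤ K := K.2
    have : v i * K = (i * K) / ((K + 1) * (d + 1)) := by simp only [v, c]; ring
    rw [this, div_lt_one (by positivity)]
    nlinarith [mul_nonneg hK0 (Nat.cast_nonneg (α := ℝ) i)]
  have hvinj : Set.InjOn v s := fun i _ j _ hij => by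
    have := mul_left_cancel₀ hc.ne' hij
    exact_mod_cast this
  have hinterp : ∀ x, D 1 x = ∑ i ∈ s, D (v i) x * (Lagrange.basis s v i).eval 1 := by
    intro x
    have h1 : P x = Lagrange.interpolate s v fun i => D (v i) x := by
      refine Lagrange.eq_interpolate_of_eval_eq _ hvinj ?_ fun i _ => hPeval x (v i)
      refine lt_of_le_of_lt Polynomial.degree_le_natDegree ?_
      simp only [s, Finset.card_range]
      exact_mod_cast Nat.lt_succ_of_le (hPdeg x)
    have h2 : D 1 x = (P x).eval 1 := (hPeval x 1).symm
    rw [h2, h1, Lagrange.interpolate_apply, Polynomial.eval_finsetSum]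
    simp
  have hsum : ∑ i ∈ s, (Lagrange.basis s v i).eval (1 : ℝ) = 1 := by
    rw [← Polynomial.eval_finsetSum, Lagrange.sum_basis hvinj ⟨0, by simp [s]⟩, Polynomial.eval_one]
  have hfin : ∫ x in ball (0 : E) 1, D 1 x = volume.real (ball (0 : E) 1) := by
    simp_rw [hinterp]
    rw [integral_finsetSum]
    · simp_rw [integral_mul_const]
      rw [Finset.sum_congr rfl fun i hi => by rw [hintegral (v i) (hv0 i) (hvK i hi)],
        ← Finset.mul_sum, hsum, mul_one]
    · intro i hi
      exact (hint (v i) (hv0 i) (hvK i hi)).mul_const _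
  rw [setIntegral_congr_fun measurableSet_ball hD1] at hfin
  simp only [integral_zero] at hfin
  have : 0 < volume.real (ball (0 : E) 1) :=
    ENNReal.toReal_pos (measure_ball_pos _ _ zero_lt_one).ne' hvol
  linarith

end Brouwer

section Zeros

open Metric Set MeasureTheory

variable {E : Type*} [NormedAddCommGroup E] [InnerProductSpace ℝ E] [FiniteDimensional ℝ E]

/-- Uniform approximation of a continuous function by smooth functions on a compact set. -/
theorem exists_contDiff_dist_le_of_isCompact {f : E → E} (hf : Continuous f) {C : Set E}
    (hC : IsCompact C) {ε : ℝ} (hε : 0 < ε) :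
    ∃ g : E → E, ContDiff ℝ 1 g ∧ ∀ x ∈ C, dist (g x) (f x) ≤ ε := by
  obtain ⟨δ, hδ, h⟩ := Metric.mem_uniformity_dist.1
    (hC.uniformContinuousAt_of_continuousAt f (fun _ _ => hf.continuousAt)
      (Metric.dist_mem_uniformity hε))
  obtain ⟨g, hg, hgf⟩ := hf.exists_contDiff_dist_le_of_forall_mem_ball_dist_le hδ
  refine ⟨g, hg.of_le (by exact_mod_cast le_top), fun x hx => hgf x ε fun y hy => ?_⟩
  have : (f x, f y) ∈ {p : E × E | dist p.1 p.2 < ε} := h (a := x) (b := y) (by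
    rw [dist_comm]; exact hy) hx
  rw [dist_comm]
  exact le_of_lt this

/-- A `C¹` vector field on the closed unit ball pointing outwards on the boundary vanishes
somewhere. -/
theorem exists_zero_of_inner_pos_of_contDiff [Nontrivial E] {P : E → E} (hP : ContDiff ℝ 1 P)
    (hpos : ∀ u ∈ sphere (0 : E) 1, 0 < inner ℝ (P u) u) :
    ∃ x ∈ closedBall (0 : E) 1, P x = 0 := by
  by_contra! hne
  let C : Set E := closedBall 0 1 ∩ {x | inner ℝ (P x) x ≤ 0}
  have hC : IsCompact C := (isCompact_closedBall _ _).inter_right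
    (isClosed_le (hP.continuous.inner continuous_id) continuous_const)
  have hC1 : ∀ x ∈ C, ‖x‖ < 1 := by
    intro x hx
    refine lt_of_le_of_ne (by simpa using hx.1) fun h => ?_
    exact absurd hx.2 (not_le.2 (hpos x (by simpa using h)))
  obtain ⟨m, hm, hmC⟩ : ∃ m > 0, ∀ x ∈ C, m ≤ (1 - ‖x‖ ^ 2) * ‖P x‖ := by
    by_cases hCe : C.Nonempty
    · obtain ⟨x, hx, hmin⟩ := hC.exists_isMinOn hCe
        (f := fun x => (1 - ‖x‖ ^ 2) * ‖P x‖) (by have := hP.continuous; fun_prop)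
      refine ⟨_, ?_, fun y hy => hmin hy⟩
      have h1 := hC1 x hx
      have h2 : 0 < ‖P x‖ := norm_pos_iff.2 (hne x hx.1)
      have h3 : 0 < 1 - ‖x‖ ^ 2 := by nlinarith [norm_nonneg x]
      positivity
    · exact ⟨1, one_pos, fun x hx => absurd ⟨x, hx⟩ hCe⟩
  let Q : E → E := fun x => ((2 / m) * (1 - ‖x‖ ^ 2)) • P x + x
  have hQ : ContDiff ℝ 1 Q :=
    ((contDiff_const.mul (contDiff_const.sub (contDiff_norm_sq ℝ))).smul hP).add contDiff_id
  have hQne : ∀ x ∈ closedBall (0 : E) 1, Q x ≠ 0 := by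
    intro x hx h0
    have hx1 : ‖x‖ ≤ 1 := by simpa using hx
    have hx2 : 0 ≤ 1 - ‖x‖ ^ 2 := by nlinarith [norm_nonneg x]
    by_cases hxC : x ∈ C
    · have h1 : ((2 / m) * (1 - ‖x‖ ^ 2)) • P x = -x := eq_neg_of_add_eq_zero_left h0
      have h2 := congrArg norm h1
      rw [norm_smul, norm_neg, Real.norm_of_nonneg (by positivity)] at h2
      have h3 := hmC x hxC
      have h4 : 2 / m * (1 - ‖x‖ ^ 2) * ‖P x‖ = 2 / m * ((1 - ‖x‖ ^ 2) * ‖P x‖) := by ring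
      have h5 : 2 / m * m ≤ 2 / m * ((1 - ‖x‖ ^ 2) * ‖P x‖) :=
        mul_le_mul_of_nonneg_left h3 (by positivity)
      rw [div_mul_cancel₀ _ hm.ne'] at h5
      linarith
    · have h1 : 0 < inner ℝ (P x) x := by
        by_contra hcon
        exact hxC ⟨hx, not_lt.1 hcon⟩
      have h2 : inner ℝ (Q x) x = (2 / m) * (1 - ‖x‖ ^ 2) * inner ℝ (P x) x + ‖x‖ ^ 2 := by
        simp only [Q, inner_add_left, real_inner_smul_left, real_inner_self_eq_norm_sq]
      rw [h0, inner_zero_left] at h2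
      have h3 : 0 ≤ (2 / m) * (1 - ‖x‖ ^ 2) * inner ℝ (P x) x := by positivity
      have h4 : ‖x‖ ^ 2 = 0 := by nlinarith [sq_nonneg ‖x‖]
      have h5 : x = 0 := by simpa using h4
      rw [h5, inner_zero_right] at h1
      exact lt_irrefl _ h1
  refine not_exists_contDiff_retraction (r := fun x => ‖Q x‖⁻¹ • Q x) (fun x hx => ?_)
    (fun x hx => norm_smul_inv_norm (𝕜 := ℝ) (hQne x hx)) (fun x hx => ?_)
  · exact ((hQ.contDiffAt.norm ℝ (hQne x hx)).inv (norm_ne_zero_iff.2 (hQne x hx))).smul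
      hQ.contDiffAt
  · have h1 : ‖x‖ = 1 := by simpa using hx
    simp [Q, h1]

/-- A continuous vector field on the closed unit ball pointing outwards on the boundary vanishes
somewhere. -/
theorem exists_zero_of_inner_pos [Nontrivial E] {P : E → E} (hP : Continuous P)
    (hpos : ∀ u ∈ sphere (0 : E) 1, 0 < inner ℝ (P u) u) :
    ∃ x ∈ closedBall (0 : E) 1, P x = 0 := by
  by_contra! hne
  obtain ⟨x₀, hx₀, hmin₀⟩ := (isCompact_closedBall (0 : E) 1).exists_isMinOn
    (nonempty_closedBall.2 zero_le_one) hP.norm.continuousOn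
  obtain ⟨x₁, hx₁, hmin₁⟩ := (isCompact_sphere (0 : E) 1).exists_isMinOn
    (NormedSpace.sphere_nonempty.2 zero_le_one) (hP.inner (𝕜 := ℝ) continuous_id).continuousOn
  have h0 : 0 < ‖P x₀‖ := norm_pos_iff.2 (hne x₀ hx₀)
  have h1 := hpos x₁ hx₁
  have hm : 0 < min ‖P x₀‖ (inner ℝ (P x₁) x₁) := lt_min h0 h1
  have hε0 : min ‖P x₀‖ (inner ℝ (P x₁) x₁) / 2 < ‖P x₀‖ :=
    lt_of_lt_of_le (half_lt_self hm) (min_le_left _ _)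
  have hε1 : min ‖P x₀‖ (inner ℝ (P x₁) x₁) / 2 < inner ℝ (P x₁) x₁ :=
    lt_of_lt_of_le (half_lt_self hm) (min_le_right _ _)
  obtain ⟨Q, hQ, hQP⟩ := exists_contDiff_dist_le_of_isCompact hP
    (isCompact_closedBall (0 : E) 1) (half_pos hm)
  obtain ⟨x, hx, hx0⟩ := exists_zero_of_inner_pos_of_contDiff hQ (fun u hu => by
    have h2 : inner ℝ (P x₁) x₁ ≤ inner ℝ (P u) u := hmin₁ hu
    have h3 := hQP u (sphere_subset_closedBall hu)
    have hu1 : ‖u‖ = 1 := by simpa using hu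
    have h4 : inner ℝ (Q u) u = inner ℝ (P u) u + inner ℝ (Q u - P u) u := by
      rw [inner_sub_left]; ring
    have h5 := abs_le.1 (abs_real_inner_le_norm (Q u - P u) u)
    rw [hu1, mul_one, ← dist_eq_norm] at h5
    rw [h4]
    linarith [h5.1])
  have h2 : ‖P x₀‖ ≤ ‖P x‖ := hmin₀ hx
  have h3 := hQP x hx
  rw [hx0, dist_zero_left] at h3
  linarith

/-- A continuous function on a Euclidean space is at distance less than one, on a given compact set,
from a continuous function with finitely many zeros. -/
theorem exists_finite_zeros_approx [Nontrivial E] {K : Set E} (hK : IsCompact K) {f : E → E}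
    (hf : Continuous f) :
    ∃ G : E → E, Continuous G ∧ {x | G x = 0}.Finite ∧ ∀ x ∈ K, ‖G x - f x‖ < 1 := by
  borelize E
  obtain ⟨w, hw⟩ := exists_norm_eq E zero_le_one
  obtain ⟨R, hR⟩ := hK.isBounded.subset_closedBall (0 : E)
  let χ : E → ℝ := fun x => max 0 (min 1 (R + 1 - ‖x‖))
  have hχ : Continuous χ := by fun_prop
  have hχ1 : ∀ x ∈ K, χ x = 1 := by
    intro x hx
    have : ‖x‖ ≤ R := by simpa using hR hx
    simp only [χ]
    rw [min_eq_left (by linarith), max_eq_right zero_le_one]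
  have hχ0 : ∀ x ∉ closedBall (0 : E) (R + 1), χ x = 0 := by
    intro x hx
    have : R + 1 < ‖x‖ := by simpa using hx
    exact max_eq_left ((min_le_right _ _).trans (by linarith))
  let F₀ : E → E := fun x => χ x • (f x - w)
  have hF₀ : UniformContinuous F₀ := by
    refine HasCompactSupport.uniformContinuous_of_continuous ?_ (hχ.smul (hf.sub continuous_const))
    refine HasCompactSupport.of_support_subset_isCompact (isCompact_closedBall (0 : E) (R + 1)) ?_
    intro x hx
    by_contra hcon
    exact hx (by simp [F₀, hχ0 x hcon])
  obtain ⟨g, hg, hgF⟩ := hF₀.exists_contDiff_dist_le (ε := 1 / 4) (by norm_num)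
  -- choose a small regular value of `g + w`
  obtain ⟨c, hc, hcreg⟩ : ∃ c : E, ‖c‖ < 1 / 4 ∧ ∀ x, g x + w = c → (fderiv ℝ g x).det ≠ 0 := by
    have h0 : volume ((fun x => g x + w) '' {x | (fderiv ℝ g x).det = 0}) = 0 :=
      addHaar_image_eq_zero_of_det_fderivWithin_eq_zero volume (f' := fderiv ℝ g)
        (fun x _ => (((hg.differentiable (by simp)) x).hasFDerivAt.add_const w).hasFDerivWithinAt)
        (fun x hx => hx)
    have h1 : ¬ ball (0 : E) (1 / 4) ⊆ (fun x => g x + w) '' {x | (fderiv ℝ g x).det = 0} :=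
      fun h => (measure_ball_pos volume (0 : E) (by norm_num : (0 : ℝ) < 1 / 4)).ne'
        (measure_mono_null h h0)
    obtain ⟨c, hc, hc'⟩ := not_subset.1 h1
    exact ⟨c, by simpa using hc, fun x hx h => hc' ⟨x, h, hx⟩⟩
  let G : E → E := fun x => g x + w - c
  have hGc : Continuous G := by have := hg.continuous; fun_prop
  refine ⟨G, hGc, ?_, ?_⟩
  · have hsub : {x | G x = 0} ⊆ closedBall (0 : E) (R + 1) := by
      intro x hx
      by_contra hcon
      have h1 := hgF x
      simp only [F₀, hχ0 x hcon, zero_smul, dist_zero_right] at h1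
      have h2 : w = c - g x := by
        have : g x + w - c = 0 := hx
        rw [eq_sub_iff_add_eq, add_comm]; exact sub_eq_zero.1 this
      have h3 := norm_sub_le c (g x)
      rw [← h2, hw] at h3
      linarith
    have hcomp : IsCompact {x | G x = 0} :=
      (isCompact_closedBall (0 : E) (R + 1)).of_isClosed_subset
      (isClosed_eq hGc continuous_const) hsub
    refine hcomp.finite ?_
    rw [isDiscrete_iff_nhdsNE]
    intro x hx
    rw [Filter.inf_principal_eq_bot]
    have hGx : HasFDerivAt G (fderiv ℝ g x) x :=
      ((((hg.differentiable (by simp)) x).hasFDerivAt.add_const w).sub_const c)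
    let e := LinearMap.equivOfDetNeZero ((fderiv ℝ g x : E →L[ℝ] E) : E →ₗ[ℝ] E)
      (hcreg x (sub_eq_zero.1 hx))
    refine hGx.eventually_ne ⟨_, e.toContinuousLinearEquiv.antilipschitz⟩
  · intro x hx
    have h1 := hgF x
    have h2 : G x - f x = (g x - F₀ x) - c := by
      simp only [G, F₀, hχ1 x hx, one_smul]; abel
    rw [dist_eq_norm] at h1
    rw [h2]
    have := norm_sub_le (g x - F₀ x) c
    linarith

end Zeros

section Connectedness

open Metric Set

/-- Removing from a preconnected set a closed set with a neighbourhood `O` such that `O \ C` is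
preconnected leaves a preconnected set. -/
theorem IsPreconnected.diff_of_subset_isOpen {M : Type*} [TopologicalSpace M] {W C O : Set M}
    (hW : IsPreconnected W) (hC : IsClosed C) (hO : IsOpen O) (hCO : C ⊆ O) (hOW : O ⊆ W)
    (hOC : IsPreconnected (O \ C)) : IsPreconnected (W \ C) := by
  have key : ∀ u v : Set M, IsOpen u → IsOpen v → W \ C ⊆ u ∪ v → (W \ C) ∩ (u ∩ v) = ∅ →
      O \ C ⊆ u → W \ C ⊆ u ∨ W \ C ⊆ v := by
    intro u v hu hv huv hd hOu
    have hd' : ∀ x ∈ W, x ∉ C → x ∈ u → x ∉ v := fun x hx hxC hxu hxv => by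
      have : x ∈ (W \ C) ∩ (u ∩ v) := ⟨⟨hx, hxC⟩, hxu, hxv⟩
      rw [hd] at this; exact this
    have hcov : W ⊆ (u ∪ O) ∪ (v \ C) := fun x hx => by
      by_cases hxC : x ∈ C
      · exact Or.inl (Or.inr (hCO hxC))
      · rcases huv ⟨hx, hxC⟩ with h | h
        · exact Or.inl (Or.inl h)
        · exact Or.inr ⟨h, hxC⟩
    have hdisj : W ∩ ((u ∪ O) ∩ (v \ C)) = ∅ := by
      refine eq_empty_of_forall_notMem ?_
      rintro x ⟨hx, hx1, hxv, hxC⟩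
      rcases hx1 with h | h
      · exact hd' x hx hxC h hxv
      · exact hd' x hx hxC (hOu ⟨h, hxC⟩) hxv
    rcases isPreconnected_iff_subset_of_disjoint.1 hW (u ∪ O) (v \ C) (hu.union hO)
      (hv.sdiff hC) hcov hdisj with h | h
    · left
      rintro x ⟨hx, hxC⟩
      rcases h hx with h | h
      · exact h
      · exact hOu ⟨h, hxC⟩
    · right
      exact fun x hx => (h hx.1).1
  rw [isPreconnected_iff_subset_of_disjoint]
  intro u v hu hv huv hd
  have hsub : O \ C ⊆ W \ C := sdiff_subset_sdiff_left hOW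
  rcases isPreconnected_iff_subset_of_disjoint.1 hOC u v hu hv (hsub.trans huv)
    (subset_empty_iff.1 (hd ▸ inter_subset_inter_left _ hsub)) with h | h
  · exact key u v hu hv huv hd h
  · exact (key v u hv hu (by rwa [union_comm]) (by rwa [inter_comm v u]) h).symm

variable {E : Type*} [NormedAddCommGroup E] [NormedSpace ℝ E]

theorem isPreconnected_norm_preimage_of_pos (h : 1 < Module.rank ℝ E) {I : Set ℝ}
    (hI : IsPreconnected I) (hpos : ∀ t ∈ I, 0 < t) : IsPreconnected {x : E | ‖x‖ ∈ I} := by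
  have : {x : E | ‖x‖ ∈ I} = (fun p : ℝ × E => p.1 • p.2) '' (I ×ˢ sphere (0 : E) 1) := by
    ext x
    constructor
    · intro hx
      have hx0 : ‖x‖ ≠ 0 := (hpos _ hx).ne'
      exact ⟨(‖x‖, ‖x‖⁻¹ • x), ⟨hx, by simp [norm_smul, hx0]⟩, by simp [smul_smul, hx0]⟩
    · rintro ⟨⟨t, u⟩, ⟨ht, hu⟩, rfl⟩
      have hu1 : ‖u‖ = 1 := by simpa using hu
      have ht0 := hpos t ht
      have : ‖t • u‖ = t := by rw [norm_smul, hu1, mul_one, Real.norm_of_nonneg ht0.le]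
      simpa [this] using ht
  rw [this]
  exact (hI.prod (isPreconnected_sphere h 0 1)).image _ (by fun_prop)

theorem isPreconnected_compl_closedBall (h : 1 < Module.rank ℝ E) {r : ℝ} (hr : 0 ≤ r) :
    IsPreconnected (closedBall (0 : E) r)ᶜ := by
  have := isPreconnected_norm_preimage_of_pos h (isPreconnected_Ioi (a := r))
    (fun t ht => hr.trans_lt ht)
  convert this using 1
  ext x; simp

theorem isPreconnected_ball_diff_center (h : 1 < Module.rank ℝ E) (p : E) (r : ℝ) :
    IsPreconnected (ball p r \ {p}) := by
  have := (isPreconnected_norm_preimage_of_pos h (isPreconnected_Ioo (a := 0) (b := r))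
    (fun t ht => ht.1)).image (fun x => p + x) (by fun_prop)
  convert this using 1
  ext x
  constructor
  · rintro ⟨hx, hxp⟩
    refine ⟨x - p, ⟨?_, ?_⟩, by simp⟩
    · exact norm_pos_iff.2 (sub_ne_zero.2 hxp)
    · simpa [dist_eq_norm] using hx
  · rintro ⟨y, ⟨hy0, hyr⟩, rfl⟩
    refine ⟨by simpa using hyr, ?_⟩
    simpa using hy0

/-- A preconnected open set in a space of dimension at least two stays preconnected after removing
finitely many points. -/
theorem IsPreconnected.diff_finite (h : 1 < Module.rank ℝ E) {W : Set E} (hW : IsPreconnected W)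
    (hWo : IsOpen W) {F : Set E} (hF : F.Finite) : IsPreconnected (W \ F) := by
  induction F, hF using Set.Finite.induction_on with
  | empty => simpa using hW
  | @insert a F _ hF ih =>
    have : W \ insert a F = (W \ F) \ {a} := by
      ext x; simp only [mem_sdiff, mem_insert_iff, mem_singleton_iff]; tauto
    rw [this]
    by_cases ha : a ∈ W \ F
    · obtain ⟨r, hr, hball⟩ := Metric.isOpen_iff.1 (hWo.sdiff hF.isClosed) a ha
      exact ih.diff_of_subset_isOpen isClosed_singleton isOpen_ball
        (singleton_subset_iff.2 (mem_ball_self hr)) hball (isPreconnected_ball_diff_center h a r)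
    · rwa [sdiff_singleton_eq_self ha]

/-- A perturbation of the identity by a contraction is a homeomorphism. -/
theorem LipschitzWith.exists_homeomorph_add [CompleteSpace E] {c : NNReal} {g : E → E}
    (hg : LipschitzWith c g) (hc : c < 1) : ∃ e : E ≃ₜ E, ∀ x, e x = x + g x := by
  have happ : ApproximatesLinearOn (fun x => x + g x)
      ((ContinuousLinearEquiv.refl ℝ E : E ≃L[ℝ] E) : E →L[ℝ] E) univ c := by
    intro x _ y _
    have : x + g x - (y + g y) - ((ContinuousLinearEquiv.refl ℝ E : E ≃L[ℝ] E) : E →L[ℝ] E) (x - y)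
        = g x - g y := by
      simp only [ContinuousLinearEquiv.coe_coe, ContinuousLinearEquiv.refl_apply]; abel
    rw [this]
    simpa [dist_eq_norm] using hg.dist_le_mul x y
  have hc' : Subsingleton E ∨ c < ‖((ContinuousLinearEquiv.refl ℝ E).symm : E →L[ℝ] E)‖₊⁻¹ := by
    rcases subsingleton_or_nontrivial E with h | h
    · exact Or.inl h
    · right
      have : ‖((ContinuousLinearEquiv.refl ℝ E).symm : E →L[ℝ] E)‖₊ = 1 := by
        simp
      rwa [this, inv_one]
  exact ⟨happ.toHomeomorph _ hc', fun x => rfl⟩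

/-- Homeomorphisms supported in a connected open set act transitively on it. -/
theorem IsPreconnected.exists_homeomorph_apply_eq [CompleteSpace E] {W : Set E}
    (hW : IsPreconnected W) (hWo : IsOpen W) {a b : E} (ha : a ∈ W) (hb : b ∈ W) :
    ∃ e : E ≃ₜ E, (∀ x ∉ W, e x = x) ∧ e a = b := by
  refine hW.induction₂ (fun a b => ∃ e : E ≃ₜ E, (∀ x ∉ W, e x = x) ∧ e a = b) ?_ ?_ ?_ ha hb
  · intro a ha
    obtain ⟨r, hr, hball⟩ := Metric.isOpen_iff.1 hWo a ha
    filter_upwards [mem_nhdsWithin_of_mem_nhds (ball_mem_nhds a hr)] with b hb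
    have hb' : ‖b - a‖ < r := by simpa [dist_eq_norm] using hb
    let g : E → E := fun x => max 0 (1 - r⁻¹ * ‖x - a‖) • (b - a)
    have hg : LipschitzWith (r⁻¹ * ‖b - a‖).toNNReal g := by
      refine LipschitzWith.of_dist_le_mul fun x y => ?_
      rw [Real.coe_toNNReal _ (by positivity), dist_eq_norm, dist_eq_norm]
      have h1 : g x - g y
          = (max 0 (1 - r⁻¹ * ‖x - a‖) - max 0 (1 - r⁻¹ * ‖y - a‖)) • (b - a) := by
        simp only [g, sub_smul]
      have h2 : |max 0 (1 - r⁻¹ * ‖x - a‖) - max 0 (1 - r⁻¹ * ‖y - a‖)| ≤ r⁻¹ * ‖x - y‖ := by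
        refine (abs_max_sub_max_le_max _ _ _ _).trans ?_
        rw [sub_self, abs_zero]
        refine max_le (by positivity) ?_
        have : 1 - r⁻¹ * ‖x - a‖ - (1 - r⁻¹ * ‖y - a‖) = r⁻¹ * (‖y - a‖ - ‖x - a‖) := by ring
        rw [this, abs_mul, abs_of_pos (inv_pos.2 hr)]
        refine mul_le_mul_of_nonneg_left ?_ (inv_pos.2 hr).le
        have := abs_norm_sub_norm_le (y - a) (x - a)
        rwa [sub_sub_sub_cancel_right, norm_sub_rev y x] at this
      rw [h1, norm_smul, Real.norm_eq_abs]
      calc _ ≤ (r⁻¹ * ‖x - y‖) * ‖b - a‖ := mul_le_mul_of_nonneg_right h2 (norm_nonneg _)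
        _ = _ := by ring
    obtain ⟨e, he⟩ := hg.exists_homeomorph_add (by
      rw [Real.toNNReal_lt_one, inv_mul_lt_one₀ hr]; exact hb')
    refine ⟨e, fun x hx => ?_, ?_⟩
    · have h1 : r ≤ ‖x - a‖ := by
        by_contra hcon
        exact hx (hball (by simpa [dist_eq_norm] using hcon))
      have h2 : 1 ≤ r⁻¹ * ‖x - a‖ := by
        rw [← inv_mul_cancel₀ hr.ne']; exact mul_le_mul_of_nonneg_left h1 (inv_pos.2 hr).le
      rw [he]
      simp only [g]
      rw [max_eq_left (by linarith), zero_smul, add_zero]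
    · rw [he]; simp [g]
  · rintro a b c _ _ _ ⟨e, he, hab⟩ ⟨e', he', hbc⟩
    exact ⟨e.trans e', fun x hx => by simp [he x hx, he' x hx], by simp [hab, hbc]⟩
  · rintro a b _ _ ⟨e, he, hab⟩
    exact ⟨e.symm, fun x hx => by rw [Homeomorph.symm_apply_eq, he x hx],
      by rw [Homeomorph.symm_apply_eq, hab]⟩

/-- If the complement of a compact set is connected, finitely many points of the complement can be
pushed arbitrarily far away by a homeomorphism fixing the compact set. -/
theorem IsCompact.exists_homeomorph_lt_norm [CompleteSpace E] (h : 1 < Module.rank ℝ E)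
    {K : Set E} (hK : IsCompact K) (hKc : IsPreconnected Kᶜ) {Z : Set E} (hZ : Z.Finite)
    (hZK : Disjoint Z K) (R : ℝ) :
    ∃ e : E ≃ₜ E, (∀ x ∈ K, e x = x) ∧ ∀ z ∈ Z, R < ‖e z‖ := by
  have : Nontrivial E := (rank_pos_iff_nontrivial (R := ℝ)).1 (zero_lt_one.trans h)
  induction Z, hZ using Set.Finite.induction_on with
  | empty => exact ⟨Homeomorph.refl E, by simp⟩
  | @insert a F haF hF ih =>
    obtain ⟨e, heK, heF⟩ := ih (hZK.mono_left (subset_insert _ _))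
    have haK : a ∉ K := disjoint_left.1 hZK (mem_insert a F)
    have hnK : ∀ x ∉ K, e x ∉ K := fun x hx hex => by
      have := e.injective (heK _ hex)
      rw [this] at hex; exact hx hex
    have hbdd : Bornology.IsBounded (closedBall (0 : E) R ∪ (K ∪ e '' F)) :=
      isBounded_closedBall.union (hK.isBounded.union (hF.image e).isBounded)
    obtain ⟨b, hb⟩ : ∃ b, b ∉ closedBall (0 : E) R ∪ (K ∪ e '' F) := by
      by_contra! hcon
      exact NormedSpace.unbounded_univ ℝ E (hbdd.subset fun x _ => hcon x)
    simp only [mem_union, not_or, mem_closedBall, dist_zero_right, not_le] at hb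
    obtain ⟨ψ, hψ, hψab⟩ := (hKc.diff_finite h hK.isClosed.isOpen_compl (hF.image e)
      ).exists_homeomorph_apply_eq (hK.isClosed.isOpen_compl.sdiff (hF.image e).isClosed)
      (a := e a) (b := b) ⟨hnK a haK, by rwa [e.injective.mem_set_image]⟩ hb.2
    refine ⟨e.trans ψ, fun x hx => ?_, ?_⟩
    · rw [Homeomorph.trans_apply, heK x hx, hψ x (fun h => h.1 hx)]
    · rintro z (rfl | hz)
      · rw [Homeomorph.trans_apply, hψab]; exact hb.1
      · rw [Homeomorph.trans_apply, hψ _ (fun h => h.2 (mem_image_of_mem e hz))]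
        exact heF z hz

end Connectedness

section Separation

open Metric Set

/-- A topological sphere of codimension one separates Euclidean space. -/
theorem not_isPreconnected_compl_of_homeomorph_sphere {E : Type*} [NormedAddCommGroup E]
    [InnerProductSpace ℝ E] [FiniteDimensional ℝ E] (h : 1 < Module.rank ℝ E) {K : Set E}
    (hK : IsCompact K) (f : K ≃ₜ sphere (0 : E) 1) : ¬ IsPreconnected Kᶜ := by
  intro hKc
  have : Nontrivial E := (rank_pos_iff_nontrivial (R := ℝ)).1 (zero_lt_one.trans h)
  obtain ⟨F, hF⟩ := ContinuousMap.exists_restrict_eq hK.isClosed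
    (⟨fun x => (f x : E), by fun_prop⟩ : C(K, E))
  obtain ⟨γ, hγ⟩ := ContinuousMap.exists_restrict_eq (isClosed_sphere (x := (0 : E)) (ε := 1))
    (⟨fun u => (f.symm u : E), by fun_prop⟩ : C(sphere (0 : E) 1, E))
  have hF' : ∀ x : K, F x = f x := fun x => congrArg (fun g : C(K, E) => g x) hF
  have hγ' : ∀ u : sphere (0 : E) 1, γ u = f.symm u := fun u =>
    congrArg (fun g : C(sphere (0 : E) 1, E) => g u) hγ
  obtain ⟨G, hG, hGfin, hGF⟩ := exists_finite_zeros_approx hK F.continuous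
  have hdisj : Disjoint {x | G x = 0} K := by
    rw [disjoint_left]
    intro x hx hxK
    have h1 := hGF x hxK
    rw [show G x = 0 from hx, hF' ⟨x, hxK⟩, zero_sub, norm_neg] at h1
    simp at h1
  obtain ⟨R, hR⟩ :=
    ((isCompact_closedBall (0 : E) 1).image γ.continuous).isBounded.subset_closedBall 0
  obtain ⟨e, heK, heZ⟩ := hK.exists_homeomorph_lt_norm h hKc hGfin hdisj R
  obtain ⟨u, hu, hu0⟩ := exists_zero_of_inner_pos (P := fun u => G (e.symm (γ u)))
    (by have := γ.continuous; have := e.symm.continuous; fun_prop) (fun u hu => by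
      have hγu := hγ' ⟨u, hu⟩
      have hmem : γ u ∈ K := by rw [hγu]; exact (f.symm ⟨u, hu⟩).2
      have h1 : e.symm (γ u) = γ u := by rw [Homeomorph.symm_apply_eq, heK _ hmem]
      have h2 : F (γ u) = u := by
        simp only at hγu
        rw [hγu, hF', Homeomorph.apply_symm_apply]
      have h3 := hGF _ hmem
      rw [h2] at h3
      have hu1 : ‖u‖ = 1 := by simpa using hu
      have h4 := abs_le.1 (abs_real_inner_le_norm (G (γ u) - u) u)
      rw [inner_sub_left, real_inner_self_eq_norm_sq, hu1] at h4
      rw [h1]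
      linarith [h4.1])
  have h1 := heZ _ hu0
  rw [Homeomorph.apply_symm_apply] at h1
  have h2 : ‖γ u‖ ≤ R := by simpa using hR (mem_image_of_mem γ hu)
  linarith

end Separation

section SphereSeparation

open Metric Set

/-- A proper closed subset of `Sⁿ` homeomorphic to `Sⁿ⁻¹` separates `Sⁿ`, for `n ≥ 2`. -/
theorem not_isPreconnected_compl_of_sphere_homeomorph_sphere {n : ℕ} (hn : 2 ≤ n)
    {K : Set (sphere (0 : EuclideanSpace ℝ (Fin (n + 1))) 1)} (hK : IsCompact K)
    (hne : K ≠ univ) (f : K ≃ₜ sphere (0 : EuclideanSpace ℝ (Fin n)) 1) :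
    ¬ IsPreconnected Kᶜ := by
  intro hconn
  have hrank : 1 < Module.rank ℝ (EuclideanSpace ℝ (Fin n)) := by
    rw [← Module.finrank_eq_rank, finrank_euclideanSpace_fin]
    exact_mod_cast hn
  have := Fact.mk (@finrank_euclideanSpace_fin ℝ _ (n + 1))
  obtain ⟨p, hp⟩ := (ne_univ_iff_exists_notMem K).1 hne
  set s := stereographic' n p with hs
  have hsrc : s.source = {p}ᶜ := stereographic'_source p
  have htgt : s.target = univ := stereographic'_target p
  have hKs : K ⊆ s.source := by
    rw [hsrc]
    rintro x hx rfl
    exact hp hx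
  have hcs : Continuous s.symm := by
    rw [← continuousOn_univ, ← htgt]
    exact s.continuousOn_symm
  have hsi : ∀ x, s (s.symm x) = x := fun x => s.right_inv (by rw [htgt]; trivial)
  have hsp : ∀ x, s.symm x ≠ p := fun x => by
    have := s.map_target (show x ∈ s.target by rw [htgt]; trivial)
    rwa [hsrc] at this
  have his : ∀ y, y ≠ p → s.symm (s y) = y := fun y hy => s.left_inv (by rw [hsrc]; exact hy)
  have hK' : IsCompact (s '' K) := hK.image_of_continuousOn (s.continuousOn.mono hKs)
  have hmem : ∀ x, s.symm x ∈ K ↔ x ∈ s '' K := by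
    intro x
    constructor
    · intro h
      exact ⟨_, h, hsi x⟩
    · rintro ⟨y, hy, rfl⟩
      rwa [his y (by rintro rfl; exact hp hy)]
  let g : K ≃ₜ s '' K :=
    { toFun := fun x => ⟨s x, mem_image_of_mem _ x.2⟩
      invFun := fun x => ⟨s.symm x, (hmem x).2 x.2⟩
      left_inv := fun x => Subtype.ext (s.left_inv (hKs x.2))
      right_inv := fun x => Subtype.ext (hsi x)
      continuous_toFun :=
        (continuousOn_iff_continuous_domRestrict.1 (s.continuousOn.mono hKs)).subtype_mk _
      continuous_invFun := (hcs.comp continuous_subtype_val).subtype_mk _ }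
  refine not_isPreconnected_compl_of_homeomorph_sphere hrank hK' (g.symm.trans f) ?_
  obtain ⟨R, hR0, hR⟩ := hK'.isBounded.subset_closedBall_lt 0 0
  have hcb : IsClosed (s.symm '' closedBall 0 R) :=
    ((isCompact_closedBall _ _).image hcs).isClosed
  have hdiff : IsPreconnected (Kᶜ \ {p}) := by
    refine hconn.diff_of_subset_isOpen isClosed_singleton hcb.isOpen_compl ?_ ?_ ?_
    · rintro x rfl ⟨y, -, hy⟩
      exact hsp y hy
    · intro x hx hxK
      exact hx ⟨s x, hR (mem_image_of_mem _ hxK), s.left_inv (hKs hxK)⟩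
    · have : (s.symm '' closedBall 0 R)ᶜ \ {p} = s.symm '' (closedBall 0 R)ᶜ := by
        ext y
        constructor
        · rintro ⟨hy, hyp⟩
          exact ⟨s y, fun h => hy ⟨_, h, his y hyp⟩, his y hyp⟩
        · rintro ⟨x, hx, rfl⟩
          refine ⟨?_, hsp x⟩
          rintro ⟨z, hz, hzx⟩
          have := congrArg s hzx
          rw [hsi, hsi] at this
          exact hx (this ▸ hz)
      rw [this]
      exact (isPreconnected_compl_closedBall hrank hR0.le).image _ hcs.continuousOn
  have himg : (s '' K)ᶜ = s '' (Kᶜ \ {p}) := by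
    ext x
    constructor
    · intro hx
      exact ⟨s.symm x, ⟨fun h => hx ((hmem x).1 h), hsp x⟩, hsi x⟩
    · rintro ⟨y, ⟨hy, hyp⟩, rfl⟩ h
      exact hy (his y hyp ▸ (hmem _).2 h)
  rw [himg]
  refine hdiff.image _ (s.continuousOn.mono ?_)
  rw [hsrc]
  exact fun x hx => hx.2

end SphereSeparation

section Components

open Metric Set Filter Topology

variable {M : Type*} [TopologicalSpace M] {A U V : Set M} {n : ℕ}

theorem subset_compl_of_mem_complComponents (hU : U ∈ complComponents A) : U ⊆ Aᶜ := by
  obtain ⟨p, -, rfl⟩ := hU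
  exact connectedComponentIn_subset _ _

theorem nonempty_of_mem_complComponents (hU : U ∈ complComponents A) : U.Nonempty := by
  obtain ⟨p, hp, rfl⟩ := hU
  exact ⟨p, mem_connectedComponentIn hp⟩

theorem isPreconnected_of_mem_complComponents (hU : U ∈ complComponents A) :
    IsPreconnected U := by
  obtain ⟨p, -, rfl⟩ := hU
  exact isPreconnected_connectedComponentIn

theorem exists_mem_complComponents {x : M} (hx : x ∉ A) : ∃ U ∈ complComponents A, x ∈ U :=
  ⟨_, ⟨x, hx, rfl⟩, mem_connectedComponentIn hx⟩

theorem eq_of_mem_of_mem_complComponents (hU : U ∈ complComponents A)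
    (hV : V ∈ complComponents A) {x : M} (hxU : x ∈ U) (hxV : x ∈ V) : U = V := by
  obtain ⟨p, -, rfl⟩ := hU
  obtain ⟨q, -, rfl⟩ := hV
  rw [connectedComponentIn_eq hxU, connectedComponentIn_eq hxV]

namespace IsFlatSCarpet

theorem isClosed (hA : IsFlatSCarpet n A) : IsClosed A := hA.1

theorem isConnected (hA : IsFlatSCarpet n A) : IsConnected A := hA.2.2.1

theorem isOpen (hA : IsFlatSCarpet n A) (hU : U ∈ complComponents A) : IsOpen U :=
  hA.2.2.2.2.1 U hU

theorem eq_of_mem_closure (hA : IsFlatSCarpet n A) (hU : U ∈ complComponents A)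
    (hV : V ∈ complComponents A) {x : M} (hxU : x ∈ closure U) (hxV : x ∈ closure V) :
    U = V := by
  by_contra hne
  exact disjoint_left.1 (hA.2.2.2.2.2.1 U hU V hV hne) hxU hxV

theorem dense_compl (hA : IsFlatSCarpet n A) : Dense Aᶜ := by
  have := hA.2.1
  rw [IsNowhereDense, hA.isClosed.closure_eq] at this
  exact interior_eq_empty_iff_dense_compl.1 this

theorem mem_iff_of_mem_closure (hA : IsFlatSCarpet n A) (hU : U ∈ complComponents A) {x : M}
    (hx : x ∈ closure U) : x ∈ A ↔ x ∉ U := by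
  refine ⟨fun h h' => subset_compl_of_mem_complComponents hU h' h, fun h => ?_⟩
  by_contra hxA
  obtain ⟨V, hV, hxV⟩ := exists_mem_complComponents hxA
  have := hA.eq_of_mem_closure hU hV hx (subset_closure hxV)
  exact h (this ▸ hxV)

theorem mem_frontier_iff (hA : IsFlatSCarpet n A) (hU : U ∈ complComponents A) {x : M} :
    x ∈ frontier U ↔ x ∈ closure U ∧ x ∈ A := by
  rw [(hA.isOpen hU).frontier_eq, Set.mem_sdiff]
  exact and_congr_right fun h => (hA.mem_iff_of_mem_closure hU h).symm

theorem frontier_subset (hA : IsFlatSCarpet n A) (hU : U ∈ complComponents A) :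
    frontier U ⊆ A := fun _ hx => ((hA.mem_frontier_iff hU).1 hx).2

/-- A flat parametrization of a neighbourhood of the closure of a complementary component. -/
theorem exists_chart [T2Space M] (hA : IsFlatSCarpet n A) (hU : U ∈ complComponents A) :
    ∃ β : EuclideanSpace ℝ (Fin n) → M, IsOpenEmbedding β ∧ β '' ball 0 1 = U ∧
      β '' closedBall 0 1 = closure U ∧ β '' sphere 0 1 = frontier U := by
  obtain ⟨V, hVo, hUV, φ, hφ⟩ := hA.2.2.2.2.2.2.1 U hU
  have hβ : IsOpenEmbedding (fun x => (φ.symm x : M)) :=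
    hVo.isOpenEmbedding_subtypeVal.comp φ.symm.isOpenEmbedding
  have hball : (fun x => (φ.symm x : M)) '' ball 0 1 = U := by
    rw [← hφ, image_image]
    ext x
    constructor
    · rintro ⟨y, hy, rfl⟩
      simpa using hy
    · intro hx
      exact ⟨⟨x, hUV (subset_closure hx)⟩, hx, by simp⟩
  have hcb : (fun x => (φ.symm x : M)) '' closedBall 0 1 = closure U := by
    apply Subset.antisymm
    · rw [← hball, ← closure_ball _ one_ne_zero]
      exact image_closure_subset_closure_image hβ.continuous
    · rw [← hball]
      exact closure_minimal (image_mono ball_subset_closedBall)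
        ((isCompact_closedBall _ _).image hβ.continuous).isClosed
  refine ⟨_, hβ, hball, hcb, ?_⟩
  rw [(hA.isOpen hU).frontier_eq, ← closedBall_sdiff_ball, image_sdiff hβ.injective, hcb, hball]

/-- There is no flat carpet of dimension one. -/
theorem false_of_one [T2Space M] (hA : IsFlatSCarpet 1 A) : False := by
  obtain ⟨⟨a, -⟩, -⟩ := hA.isConnected
  obtain ⟨b, hb⟩ := hA.dense_compl.nonempty_iff.2 ⟨a⟩
  obtain ⟨U, hU, -⟩ := exists_mem_complComponents hb
  obtain ⟨β, hβ, hball, -, hsph⟩ := hA.exists_chart hU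
  set c : ℝ → EuclideanSpace ℝ (Fin 1) := fun t => !₂[t] with hc
  have hcn : ∀ t, ‖c t‖ = |t| := fun t => by
    simp [hc, EuclideanSpace.norm_eq, Real.sqrt_sq_eq_abs]
  have hcx : ∀ x : EuclideanSpace ℝ (Fin 1), c (x 0) = x := fun x => by
    ext i
    fin_cases i
    simp [hc]
  have hcont : Continuous fun x : EuclideanSpace ℝ (Fin 1) => x 0 := by fun_prop
  have hcc : Continuous c := by
    rw [hc]
    fun_prop
  have hmemA : ∀ t, |t| = 1 → β (c t) ∈ A := fun t ht =>
    hA.frontier_subset hU (hsph ▸ mem_image_of_mem _ (by simp [hcn, ht]))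
  have hnotA : β (c 0) ∉ A := fun h =>
    subset_compl_of_mem_complComponents hU
      (hball ▸ mem_image_of_mem _ (by simp [hcn])) h
  obtain ⟨y, ⟨q, ⟨hq1, hq2⟩, rfl⟩, hqA⟩ : (β '' ((fun x => x 0) ⁻¹' Ioo 1 2) ∩ Aᶜ).Nonempty :=
    hA.dense_compl.inter_open_nonempty _ (hβ.isOpenMap _ (isOpen_Ioo.preimage hcont))
      ⟨_, mem_image_of_mem _ (show c (3 / 2) ∈ _ by simp [hc]; norm_num)⟩
  set D := β '' ((fun x => x 0) ⁻¹' Ioo 0 (q 0)) with hD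
  have hDo : IsOpen D := hβ.isOpenMap _ (isOpen_Ioo.preimage hcont)
  have hDc : IsClosed (β '' (c '' Icc 0 (q 0))) :=
    ((isCompact_Icc.image hcc).image hβ.continuous).isClosed
  have hsub : A ⊆ D ∪ (β '' (c '' Icc 0 (q 0)))ᶜ := by
    intro x hx
    by_cases h : x ∈ β '' (c '' Icc 0 (q 0))
    · obtain ⟨_, ⟨t, ⟨ht0, htq⟩, rfl⟩, rfl⟩ := h
      refine Or.inl (mem_image_of_mem _ (show c t ∈ _ from ?_))
      have h0 : t ≠ 0 := by
        rintro rfl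
        exact hnotA hx
      have h1 : t ≠ q 0 := by
        rintro rfl
        rw [hcx] at hx
        exact hqA hx
      simp only [mem_preimage]
      exact ⟨lt_of_le_of_ne ht0 h0.symm, lt_of_le_of_ne htq h1⟩
    · exact Or.inr h
  obtain ⟨z, -, ⟨w, hw, hwz⟩, hz⟩ := hA.isConnected.isPreconnected D _ hDo hDc.isOpen_compl hsub
    ⟨β (c 1), hmemA 1 (by simp), mem_image_of_mem _ ⟨by simp [hc], by simpa [hc] using hq1⟩⟩
    ⟨β (c (-1)), hmemA (-1) (by simp), by
      rintro ⟨_, ⟨t, ht, rfl⟩, htt⟩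
      have := congrArg (fun x => x 0) (hβ.injective htt)
      simp [hc] at this
      linarith [ht.1]⟩
  exact hz ⟨w, ⟨w 0, ⟨hw.1.le, hw.2.le⟩, hcx w⟩, hwz⟩

end IsFlatSCarpet

end Components

section CarpetTopology

open Metric Set Filter Topology

namespace IsFlatSCarpet

variable {M : Type*} [TopologicalSpace M] {A U V : Set M} {n : ℕ}

/-- Near a point `x`, all complementary components of a carpet are small, except possibly the one
whose closure contains `x`. -/
theorem exists_isOpen_closure_subset [FirstCountableTopology M] (hA : IsFlatSCarpet n A) {x : M}
    {W : Set M} (hW : IsOpen W) (hx : x ∈ W) :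
    ∃ N, IsOpen N ∧ x ∈ N ∧ ∀ U ∈ complComponents A, x ∉ closure U → (closure U ∩ N).Nonempty →
      closure U ⊆ W := by
  by_contra! hcon
  obtain ⟨B, hB⟩ := (𝓝 x).exists_antitone_basis
  have hBm : ∀ k, x ∈ interior (B k) := fun k =>
    mem_interior_iff_mem_nhds.2 (hB.1.mem_of_mem trivial)
  choose U hU hxU hUN hUW using fun k => hcon (interior (B k)) isOpen_interior (hBm k)
  choose y hyU hyB using hUN
  have hy : Tendsto y atTop (𝓝 x) := hB.tendsto fun k => interior_subset (hyB k)
  have hinf : (range U).Infinite := by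
    intro hfin
    have hcl : IsClosed (⋃ V ∈ range U, closure V) :=
      hfin.isClosed_biUnion fun _ _ => isClosed_closure
    have hxn : x ∉ ⋃ V ∈ range U, closure V := by
      simp only [mem_range, iUnion_exists, iUnion_iUnion_eq', mem_iUnion, not_exists]
      exact hxU
    obtain ⟨k, hk⟩ := (hy.eventually (hcl.isOpen_compl.mem_nhds hxn)).exists
    exact hk (mem_biUnion (mem_range_self k) (hyU k))
  choose m hm using fun k => (hinf.natEmbedding _ k).2
  have hinj : Function.Injective (U ∘ m) := fun i j hij => by
    simp only [Function.comp_apply, hm] at hij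
    exact (hinf.natEmbedding _).injective (Subtype.ext hij)
  obtain ⟨k, hk⟩ := (hA.2.2.2.2.2.2.2 (U ∘ m) (fun k => hU _) hinj (y ∘ m) (fun k => hyU _) x
    (hy.comp hinj.of_comp.nat_tendsto_atTop) W hW hx).exists
  exact hUW _ hk

theorem exists_sphere_homeomorph_frontier [T2Space M] (hA : IsFlatSCarpet n A)
    (hU : U ∈ complComponents A) :
    Nonempty (sphere (0 : EuclideanSpace ℝ (Fin n)) 1 ≃ₜ frontier U) := by
  obtain ⟨β, hβ, -, -, hs⟩ := hA.exists_chart hU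
  exact ⟨(hβ.isEmbedding.homeomorphImage _).trans (Homeomorph.setCongr hs)⟩

theorem isConnected_frontier
    (hrank : 1 < Module.rank ℝ (EuclideanSpace ℝ (Fin n))) [T2Space M]
    (hA : IsFlatSCarpet n A) (hU : U ∈ complComponents A) :
    IsConnected (frontier U) := by
  obtain ⟨β, hβ, -, -, hs⟩ := hA.exists_chart hU
  rw [← hs]
  exact (isConnected_sphere hrank 0 zero_le_one).image _ hβ.continuous.continuousOn

theorem isPreconnected_compl_closure
    (hrank : 1 < Module.rank ℝ (EuclideanSpace ℝ (Fin n))) [T2Space M]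
    [PreconnectedSpace M] (hA : IsFlatSCarpet n A)
    (hU : U ∈ complComponents A) : IsPreconnected (closure U)ᶜ := by
  obtain ⟨β, hβ, -, hc, -⟩ := hA.exists_chart hU
  rw [compl_eq_univ_sdiff]
  refine isPreconnected_univ.diff_of_subset_isOpen isClosed_closure hβ.isOpen_range ?_
    (subset_univ _) ?_
  · rw [← hc]
    exact image_subset_range _ _
  · rw [← hc, ← image_univ, ← image_sdiff hβ.injective, ← compl_eq_univ_sdiff]
    exact (isPreconnected_compl_closedBall hrank zero_le_one).image _ hβ.continuous.continuousOn

/-- Removing a peripheral sphere from a carpet does not disconnect it. -/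
theorem isPreconnected_diff_closure
    (hrank : 1 < Module.rank ℝ (EuclideanSpace ℝ (Fin n))) [T2Space M]
    [PreconnectedSpace M] [FirstCountableTopology M]
    (hA : IsFlatSCarpet n A) (hU : U ∈ complComponents A) : IsPreconnected (A \ closure U) := by
  have hfr : ∀ V ∈ complComponents A, V ≠ U → frontier V ⊆ A \ closure U := fun V hV hne x hx =>
    ⟨hA.frontier_subset hV hx,
      fun h => hne (hA.eq_of_mem_closure hV hU (frontier_subset_closure hx) h)⟩
  let P : Set M → Set M := fun w => {y | y ∉ closure U ∧ ((y ∈ A ∧ y ∈ w) ∨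
    ∃ V ∈ complComponents A, V ≠ U ∧ y ∈ V ∧ frontier V ⊆ w)}
  have hPo : ∀ w, IsOpen w → (∀ V ∈ complComponents A, V ≠ U → ∀ y ∈ frontier V, y ∈ w →
      frontier V ⊆ w) → IsOpen (P w) := by
    intro w hw hdich
    rw [isOpen_iff_mem_nhds]
    rintro y ⟨hyU, ⟨hyA, hyw⟩ | ⟨V, hV, hne, hyV, hVw⟩⟩
    · obtain ⟨N, hN, hyN, hNW⟩ := hA.exists_isOpen_closure_subset
        (hw.inter isClosed_closure.isOpen_compl) ⟨hyw, hyU⟩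
      filter_upwards [hN.mem_nhds hyN, hw.mem_nhds hyw,
        isClosed_closure.isOpen_compl.mem_nhds hyU] with z hzN hzw hzU
      refine ⟨hzU, ?_⟩
      by_cases hzA : z ∈ A
      · exact Or.inl ⟨hzA, hzw⟩
      · obtain ⟨V, hV, hzV⟩ := exists_mem_complComponents hzA
        have hne : V ≠ U := by
          rintro rfl
          exact hzU (subset_closure hzV)
        refine Or.inr ⟨V, hV, hne, hzV, ?_⟩
        by_cases hyV : y ∈ closure V
        · exact hdich V hV hne y ((hA.mem_frontier_iff hV).2 ⟨hyV, hyA⟩) hyw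
        · exact fun t ht => (hNW V hV hyV ⟨z, subset_closure hzV, hzN⟩
            (frontier_subset_closure ht)).1
    · filter_upwards [(hA.isOpen hV).mem_nhds hyV] with z hz
      exact ⟨fun h => hne (hA.eq_of_mem_closure hV hU (subset_closure hz) h),
        Or.inr ⟨V, hV, hne, hz, hVw⟩⟩
  rw [isPreconnected_iff_subset_of_disjoint]
  intro u v hu hv huv hd
  have hd' : ∀ x ∈ A \ closure U, x ∈ u → x ∉ v := fun x hx hxu hxv => by
    have : x ∈ (A \ closure U) ∩ (u ∩ v) := ⟨hx, hxu, hxv⟩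
    rwa [hd] at this
  have hsplit : ∀ V ∈ complComponents A, V ≠ U → frontier V ⊆ u ∨ frontier V ⊆ v := by
    intro V hV hne
    refine isPreconnected_iff_subset_of_disjoint.1 (hA.isConnected_frontier hrank hV).isPreconnected
      u v hu hv ((hfr V hV hne).trans huv) (eq_empty_of_forall_notMem ?_)
    rintro x ⟨hx, hxu, hxv⟩
    exact hd' x (hfr V hV hne hx) hxu hxv
  have hPu := hPo u hu fun V hV hne y hy hyu => (hsplit V hV hne).resolve_right
    fun h => hd' y (hfr V hV hne hy) hyu (h hy)
  have hPv := hPo v hv fun V hV hne y hy hyv => (hsplit V hV hne).resolve_left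
    fun h => hd' y (hfr V hV hne hy) (h hy) hyv
  have hcov : (closure U)ᶜ ⊆ P u ∪ P v := by
    intro y hy
    by_cases hyA : y ∈ A
    · exact (huv ⟨hyA, hy⟩).imp (fun h => ⟨hy, Or.inl ⟨hyA, h⟩⟩) fun h => ⟨hy, Or.inl ⟨hyA, h⟩⟩
    · obtain ⟨V, hV, hyV⟩ := exists_mem_complComponents hyA
      have hne : V ≠ U := by
        rintro rfl
        exact hy (subset_closure hyV)
      exact (hsplit V hV hne).imp (fun h => ⟨hy, Or.inr ⟨V, hV, hne, hyV, h⟩⟩)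
        fun h => ⟨hy, Or.inr ⟨V, hV, hne, hyV, h⟩⟩
  have hdisj : (closure U)ᶜ ∩ (P u ∩ P v) = ∅ := by
    refine eq_empty_of_forall_notMem ?_
    rintro y ⟨hy, ⟨-, h1⟩, -, h2⟩
    rcases h1 with ⟨hyA, hyu⟩ | ⟨V, hV, hne, hyV, hVu⟩ <;>
      rcases h2 with ⟨hyA', hyv⟩ | ⟨V', hV', hne', hyV', hVv⟩
    · exact hd' y ⟨hyA, hy⟩ hyu hyv
    · exact subset_compl_of_mem_complComponents hV' hyV' hyA
    · exact subset_compl_of_mem_complComponents hV hyV hyA'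
    · obtain rfl := eq_of_mem_of_mem_complComponents hV hV' hyV hyV'
      obtain ⟨t, ht⟩ := (hA.isConnected_frontier hrank hV).nonempty
      exact hd' t (hfr V hV hne ht) (hVu ht) (hVv ht)
  have hback : ∀ w, (closure U)ᶜ ⊆ P w → A \ closure U ⊆ w := by
    rintro w hw y ⟨hyA, hyU⟩
    rcases (hw hyU).2 with ⟨-, h⟩ | ⟨V, hV, -, hyV, -⟩
    · exact h
    · exact absurd hyA (subset_compl_of_mem_complComponents hV hyV)
  exact (isPreconnected_iff_subset_of_disjoint.1 (hA.isPreconnected_compl_closure hrank hU) _ _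
    hPu hPv hcov hdisj).imp (hback u) (hback v)

theorem exists_frontier_subset_image
    (hrank : 1 < Module.rank ℝ (EuclideanSpace ℝ (Fin n))) [T2Space M]
    [CompactSpace M] [PreconnectedSpace M] [FirstCountableTopology M]
    (hsep : ∀ K : Set M, IsCompact K → K ≠ univ →
      Nonempty (K ≃ₜ sphere (0 : EuclideanSpace ℝ (Fin n)) 1) → ¬ IsPreconnected Kᶜ)
    {X Y : Set M} (hX : IsFlatSCarpet n X) (hY : IsFlatSCarpet n Y) (h : X ≃ₜ Y)
    (hU : U ∈ complComponents X) :
    ∃ V ∈ complComponents Y, ∀ y : Y, (y : M) ∈ frontier V → (h.symm y : M) ∈ frontier U := by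
  obtain ⟨e⟩ := hX.exists_sphere_homeomorph_frontier hU
  set g : sphere (0 : EuclideanSpace ℝ (Fin n)) 1 → M :=
    fun s => h ⟨e s, hX.frontier_subset hU (e s).2⟩ with hg
  have hgc : Continuous g := by
    rw [hg]
    fun_prop
  have hgi : Function.Injective g := fun s t hst => by
    have := congrArg Subtype.val (h.injective (Subtype.ext hst))
    exact e.injective (Subtype.ext this)
  have hgY : range g ⊆ Y := by
    rintro _ ⟨s, rfl⟩
    exact Subtype.coe_prop _
  have hmem : ∀ x : X, (h x : M) ∈ range g ↔ (x : M) ∈ frontier U := by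
    intro x
    constructor
    · rintro ⟨s, hs⟩
      have := congrArg Subtype.val (h.injective (Subtype.ext hs))
      rw [← this]
      exact (e s).2
    · intro hx
      exact ⟨e.symm ⟨x, hx⟩, by simp [hg]⟩
  have hne : range g ≠ univ := by
    intro hr
    obtain ⟨⟨a, -⟩, -⟩ := hY.isConnected
    obtain ⟨b, hb⟩ := hY.dense_compl.nonempty_iff.2 ⟨a⟩
    exact hb (hgY (hr ▸ mem_univ b))
  have hemb : IsClosedEmbedding g := hgc.isClosedEmbedding hgi
  have hnot := hsep (range g) (isCompact_range hgc) hne ⟨hemb.isEmbedding.toHomeomorph.symm⟩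
  have hdiff : IsPreconnected (Y \ range g) := by
    have : Y \ range g = (fun x : X => (h x : M)) '' (Subtype.val ⁻¹' (X \ closure U)) := by
      ext y
      constructor
      · rintro ⟨hy, hyg⟩
        refine ⟨h.symm ⟨y, hy⟩, ⟨Subtype.coe_prop _, fun hc => hyg ?_⟩, by simp⟩
        have := (hmem (h.symm ⟨y, hy⟩)).2 ((hX.mem_frontier_iff hU).2 ⟨hc, Subtype.coe_prop _⟩)
        simpa using this
      · rintro ⟨x, ⟨-, hx⟩, rfl⟩
        exact ⟨(h x).2, fun hc => hx (frontier_subset_closure ((hmem x).1 hc))⟩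
    rw [this]
    refine IsPreconnected.image ?_ _ (by fun_prop)
    rw [← IsInducing.subtypeVal.isPreconnected_image, Subtype.image_preimage_coe,
      inter_eq_right.2 sdiff_subset]
    exact hX.isPreconnected_diff_closure hrank hU
  by_contra! hcon
  have hcon' : ∀ V ∈ complComponents Y, ∃ y ∈ frontier V, y ∈ Y \ range g := by
    intro V hV
    obtain ⟨y, hyV, hy⟩ := hcon V hV
    refine ⟨y, hyV, y.2, fun hc => hy ?_⟩
    rw [← hmem, h.apply_symm_apply]
    exact hc
  refine hnot ?_
  obtain ⟨⟨a, -⟩, -⟩ := hY.isConnected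
  obtain ⟨b, hb⟩ := hY.dense_compl.nonempty_iff.2 ⟨a⟩
  obtain ⟨V₀, hV₀, -⟩ := exists_mem_complComponents hb
  obtain ⟨y₀, -, hy₀⟩ := hcon' V₀ hV₀
  refine isPreconnected_of_forall y₀ fun y hy => ?_
  by_cases hyY : y ∈ Y
  · exact ⟨Y \ range g, fun z hz => hz.2, hy₀, ⟨hyY, hy⟩, hdiff⟩
  · obtain ⟨V, hV, hyV⟩ := exists_mem_complComponents hyY
    obtain ⟨q, hqV, hq⟩ := hcon' V hV
    refine ⟨insert q V ∪ (Y \ range g), ?_, Or.inr hy₀, Or.inl (Or.inr hyV), ?_⟩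
    · rintro z ((rfl | hz) | hz)
      · exact hq.2
      · exact fun hc => subset_compl_of_mem_complComponents hV hz (hgY hc)
      · exact hz.2
    · refine IsPreconnected.union q (mem_insert _ _) hq ?_ hdiff
      exact (isPreconnected_of_mem_complComponents hV).subset_closure (subset_insert _ _)
        (insert_subset (frontier_subset_closure hqV) subset_closure)

/-- A homeomorphism between flat carpets maps peripheral spheres to peripheral spheres. -/
theorem exists_mem_frontier_iff
    (hrank : 1 < Module.rank ℝ (EuclideanSpace ℝ (Fin n))) [T2Space M]
    [CompactSpace M] [PreconnectedSpace M] [FirstCountableTopology M]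
    (hsep : ∀ K : Set M, IsCompact K → K ≠ univ →
      Nonempty (K ≃ₜ sphere (0 : EuclideanSpace ℝ (Fin n)) 1) → ¬ IsPreconnected Kᶜ)
    {X Y : Set M} (hX : IsFlatSCarpet n X) (hY : IsFlatSCarpet n Y) (h : X ≃ₜ Y)
    (hU : U ∈ complComponents X) :
    ∃ V ∈ complComponents Y, ∀ x : X, (x : M) ∈ frontier U ↔ (h x : M) ∈ frontier V := by
  obtain ⟨V, hV, hVU⟩ := exists_frontier_subset_image hrank hsep hX hY h hU
  obtain ⟨U', hU', hUV⟩ := exists_frontier_subset_image hrank hsep hY hX h.symm hV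
  have hVU' : ∀ x : X, (h x : M) ∈ frontier V → (x : M) ∈ frontier U := fun x hx => by
    simpa using hVU _ hx
  obtain ⟨t, ht⟩ := (hX.isConnected_frontier hrank hU').nonempty
  have ht' := hVU' _ (hUV ⟨t, hX.frontier_subset hU' ht⟩ ht)
  obtain rfl := hX.eq_of_mem_closure hU' hU (frontier_subset_closure ht)
    (frontier_subset_closure ht')
  exact ⟨V, hV, fun x => ⟨hUV x, hVU' x⟩⟩

end IsFlatSCarpet

end CarpetTopology

section Radial

open Metric Set Filter Topology

variable {E : Type*} [NormedAddCommGroup E] [NormedSpace ℝ E]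

/-- The cone over a self-map of the unit sphere. -/
noncomputable def radialExtension (σ : sphere (0 : E) 1 → sphere (0 : E) 1) (x : E) : E :=
  open Classical in
  if hx : x = 0 then 0 else
    ‖x‖ • (σ ⟨‖x‖⁻¹ • x, by simp [norm_smul, hx]⟩ : E)

theorem radialExtension_zero (σ : sphere (0 : E) 1 → sphere (0 : E) 1) :
    radialExtension σ 0 = 0 := by
  simp [radialExtension]

theorem radialExtension_smul (σ : sphere (0 : E) 1 → sphere (0 : E) 1) (u : sphere (0 : E) 1)
    {t : ℝ} (ht : 0 < t) : radialExtension σ (t • (u : E)) = t • (σ u : E) := by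
  have hu : ‖(u : E)‖ = 1 := by simp
  have hn : ‖t • (u : E)‖ = t := by rw [norm_smul, hu, mul_one, Real.norm_of_nonneg ht.le]
  have hne : t • (u : E) ≠ 0 := by
    rw [← norm_ne_zero_iff, hn]
    exact ht.ne'
  have heq :
      (⟨‖t • (u : E)‖⁻¹ • t • (u : E), by simp [norm_smul, ht.ne']⟩ : sphere (0 : E) 1) = u :=
    Subtype.ext (by simp only [hn, smul_smul, inv_mul_cancel₀ ht.ne', one_smul])
  rw [radialExtension, dif_neg hne, heq, hn]

theorem exists_eq_smul_sphere {x : E} (hx : x ≠ 0) :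
    ∃ u : sphere (0 : E) 1, x = ‖x‖ • (u : E) :=
  ⟨⟨‖x‖⁻¹ • x, by simp [norm_smul, hx]⟩, by simp [smul_smul, hx]⟩

theorem radialExtension_coe (σ : sphere (0 : E) 1 → sphere (0 : E) 1) (u : sphere (0 : E) 1) :
    radialExtension σ (u : E) = σ u := by
  simpa using radialExtension_smul σ u one_pos

theorem norm_radialExtension (σ : sphere (0 : E) 1 → sphere (0 : E) 1) (x : E) :
    ‖radialExtension σ x‖ = ‖x‖ := by
  by_cases hx : x = 0
  · rw [hx, radialExtension_zero]
  · rw [radialExtension, dif_neg hx, norm_smul, norm_norm, norm_eq_of_mem_sphere, mul_one]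

theorem radialExtension_radialExtension {σ τ : sphere (0 : E) 1 → sphere (0 : E) 1}
    (h : ∀ u, σ (τ u) = u) (x : E) : radialExtension σ (radialExtension τ x) = x := by
  by_cases hx : x = 0
  · simp [hx, radialExtension_zero]
  · obtain ⟨u, hu⟩ := exists_eq_smul_sphere hx
    have hpos := norm_pos_iff.2 hx
    rw [hu, radialExtension_smul _ _ hpos, radialExtension_smul _ _ hpos, h]

theorem continuous_radialExtension {σ : sphere (0 : E) 1 → sphere (0 : E) 1}
    (hσ : Continuous σ) : Continuous (radialExtension σ) := by
  rw [continuous_iff_continuousAt]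
  intro x
  by_cases hx : x = 0
  · subst hx
    rw [ContinuousAt, radialExtension_zero, tendsto_zero_iff_norm_tendsto_zero]
    simp only [norm_radialExtension]
    exact tendsto_norm_zero
  · have : ContinuousOn (radialExtension σ) {0}ᶜ := by
      rw [continuousOn_iff_continuous_domRestrict]
      have heq : ({0}ᶜ : Set E).domRestrict (radialExtension σ) = fun y : ({0}ᶜ : Set E) =>
          ‖(y : E)‖ • (σ ⟨‖(y : E)‖⁻¹ • (y : E), by
            simp [norm_smul, inv_mul_cancel₀ (norm_ne_zero_iff.2 y.2)]⟩ : E) := by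
        funext y
        exact dif_neg y.2
      rw [heq]
      have hinv : Continuous fun y : ({0}ᶜ : Set E) => ‖(y : E)‖⁻¹ :=
        continuous_subtype_val.norm.inv₀ fun y => norm_ne_zero_iff.2 y.2
      exact continuous_subtype_val.norm.smul (continuous_subtype_val.comp (hσ.comp
        ((hinv.smul continuous_subtype_val).subtype_mk _)))
    exact this.continuousAt (isOpen_compl_singleton.mem_nhds hx)

end Radial

section Extension

open Metric Set Filter Topology

namespace IsFlatSCarpet

variable {M : Type*} [TopologicalSpace M] {n : ℕ}

/-- A homeomorphism between peripheral spheres extends over the complementary components. -/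
theorem exists_extension_closure [T2Space M] {X Y : Set M} (hX : IsFlatSCarpet n X)
    (hY : IsFlatSCarpet n Y) (h : X ≃ₜ Y) {U V : Set M} (hU : U ∈ complComponents X)
    (hV : V ∈ complComponents Y)
    (hUV : ∀ x : X, (x : M) ∈ frontier U ↔ (h x : M) ∈ frontier V) :
    ∃ θ : M → M, ContinuousOn θ (closure U) ∧ BijOn θ U V ∧
      ∀ x : X, (x : M) ∈ frontier U → θ x = h x := by
  obtain ⟨β, hβ, hβb, hβc, hβs⟩ := hX.exists_chart hU
  obtain ⟨γ, hγ, hγb, hγc, hγs⟩ := hY.exists_chart hV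
  have hβm : ∀ u : sphere (0 : EuclideanSpace ℝ (Fin n)) 1, β u ∈ frontier U := fun u =>
    hβs ▸ mem_image_of_mem _ u.2
  have hγm : ∀ u : sphere (0 : EuclideanSpace ℝ (Fin n)) 1, γ u ∈ frontier V := fun u =>
    hγs ▸ mem_image_of_mem _ u.2
  let b := hβ.toOpenPartialHomeomorph β
  let c := hγ.toOpenPartialHomeomorph γ
  have hb : ∀ x, b.symm (β x) = x := fun x => b.left_inv (by simp [b])
  have hc : ∀ x, c.symm (γ x) = x := fun x => c.left_inv (by simp [c])
  have hbc : ContinuousOn b.symm (range β) := by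
    simpa [b] using b.continuousOn_symm
  have hcc : ContinuousOn c.symm (range γ) := by
    simpa [c] using c.continuousOn_symm
  have hγim : ∀ u : sphere (0 : EuclideanSpace ℝ (Fin n)) 1,
      ∃ v : sphere (0 : EuclideanSpace ℝ (Fin n)) 1,
        γ v = h ⟨β u, hX.frontier_subset hU (hβm u)⟩ := by
    intro u
    have := (hUV ⟨β u, hX.frontier_subset hU (hβm u)⟩).1 (hβm u)
    rw [← hγs] at this
    obtain ⟨v, hv, hvu⟩ := this
    exact ⟨⟨v, hv⟩, hvu⟩
  have hβim : ∀ v : sphere (0 : EuclideanSpace ℝ (Fin n)) 1,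
      ∃ u : sphere (0 : EuclideanSpace ℝ (Fin n)) 1,
        β u = h.symm ⟨γ v, hY.frontier_subset hV (hγm v)⟩ := by
    intro v
    have := (hUV (h.symm ⟨γ v, hY.frontier_subset hV (hγm v)⟩)).2 (by simpa using hγm v)
    rw [← hβs] at this
    obtain ⟨u, hu, huv⟩ := this
    exact ⟨⟨u, hu⟩, huv⟩
  choose σ hσ using hγim
  choose τ hτ using hβim
  have hβinj : Function.Injective fun u : sphere (0 : EuclideanSpace ℝ (Fin n)) 1 => β u :=
    hβ.injective.comp Subtype.val_injective
  have hγinj : Function.Injective fun u : sphere (0 : EuclideanSpace ℝ (Fin n)) 1 => γ u :=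
    hγ.injective.comp Subtype.val_injective
  have hτσ : ∀ u, τ (σ u) = u := fun u => hβinj (by
    simp only [hτ]
    simp only [hσ, Subtype.coe_eta, Homeomorph.symm_apply_apply])
  have hστ : ∀ v, σ (τ v) = v := fun v => hγinj (by
    simp only [hσ]
    simp only [hτ, Subtype.coe_eta, Homeomorph.apply_symm_apply])
  have hσc : Continuous σ := by
    have hind : IsEmbedding fun u : sphere (0 : EuclideanSpace ℝ (Fin n)) 1 => γ u :=
      hγ.isEmbedding.comp IsEmbedding.subtypeVal
    rw [hind.continuous_iff]
    have : (fun u : sphere (0 : EuclideanSpace ℝ (Fin n)) 1 => γ u) ∘ σ =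
        fun u : sphere (0 : EuclideanSpace ℝ (Fin n)) 1 =>
          (h ⟨β u, hX.frontier_subset hU (hβm u)⟩ : M) := funext hσ
    rw [this]
    have hβ' := hβ.continuous
    fun_prop
  have hsub : closure U ⊆ range β := by
    rw [← hβc]
    exact image_subset_range _ _
  refine ⟨fun x => γ (radialExtension σ (b.symm x)),
    (hγ.continuous.comp (continuous_radialExtension hσc)).comp_continuousOn (hbc.mono hsub),
    ⟨?_, ?_, ?_⟩, ?_⟩
  · rw [← hβb, ← hγb]
    rintro _ ⟨x, hx, rfl⟩
    refine mem_image_of_mem _ ?_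
    rw [hb, mem_ball_zero_iff, norm_radialExtension]
    exact mem_ball_zero_iff.1 hx
  · rw [← hβb]
    rintro _ ⟨x, hx, rfl⟩ _ ⟨y, hy, rfl⟩ hxy
    have := congrArg (radialExtension τ) (hγ.injective hxy)
    rw [hb, hb, radialExtension_radialExtension hτσ, radialExtension_radialExtension hτσ] at this
    rw [this]
  · rw [← hβb, ← hγb]
    rintro _ ⟨y, hy, rfl⟩
    refine ⟨β (radialExtension τ y), mem_image_of_mem _ ?_, ?_⟩
    · rw [mem_ball_zero_iff, norm_radialExtension]
      exact mem_ball_zero_iff.1 hy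
    · simp only [hb, radialExtension_radialExtension hστ]
  · intro x hx
    have hx' := hx
    rw [← hβs] at hx'
    obtain ⟨u, hu, hux⟩ := hx'
    have hxe : x = ⟨β u, hX.frontier_subset hU (hβm ⟨u, hu⟩)⟩ := Subtype.ext hux.symm
    simp only [← hux, hb]
    rw [radialExtension_coe σ ⟨u, hu⟩, hσ, hxe]

/-- Any homeomorphism between flat carpets of dimension `n ≥ 2` extends to the ambient space, if
every proper embedded `(n - 1)`-sphere separates that space. -/
theorem exists_homeomorph_extension [T2Space M] [CompactSpace M] [PreconnectedSpace M]
    [FirstCountableTopology M] (hrank : 1 < Module.rank ℝ (EuclideanSpace ℝ (Fin n)))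
    (hsep : ∀ K : Set M, IsCompact K → K ≠ univ →
      Nonempty (K ≃ₜ sphere (0 : EuclideanSpace ℝ (Fin n)) 1) → ¬ IsPreconnected Kᶜ)
    {X Y : Set M} (hX : IsFlatSCarpet n X) (hY : IsFlatSCarpet n Y) (h : X ≃ₜ Y) :
    ∃ H : M ≃ₜ M, ∀ x : X, H x = h x := by
  choose! τ hτ hτf using fun U (hU : U ∈ complComponents X) =>
    exists_mem_frontier_iff hrank hsep hX hY h hU
  have : Nonempty (M → M) := ⟨id⟩
  choose! θ hθc hθb hθf using fun U (hU : U ∈ complComponents X) =>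
    hX.exists_extension_closure hY h hU (hτ U hU) (hτf U hU)
  have hτinj : ∀ U ∈ complComponents X, ∀ V ∈ complComponents X, τ U = τ V → U = V := by
    intro U hU V hV hUV
    obtain ⟨t, ht⟩ := (hX.isConnected_frontier hrank hU).nonempty
    have h1 := (hτf U hU ⟨t, hX.frontier_subset hU ht⟩).1 ht
    rw [hUV] at h1
    exact hX.eq_of_mem_closure hU hV (frontier_subset_closure ht)
      (frontier_subset_closure ((hτf V hV ⟨t, hX.frontier_subset hU ht⟩).2 h1))
  have hτsurj : ∀ V ∈ complComponents Y, ∃ U ∈ complComponents X, τ U = V := by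
    intro V hV
    obtain ⟨U, hU, hVU⟩ := exists_mem_frontier_iff hrank hsep hY hX h.symm hV
    obtain ⟨t, ht⟩ := (hY.isConnected_frontier hrank hV).nonempty
    have h1 := (hτf U hU _).1 ((hVU ⟨t, hY.frontier_subset hV ht⟩).1 ht)
    rw [h.apply_symm_apply] at h1
    exact ⟨U, hU, hY.eq_of_mem_closure (hτ U hU) hV (frontier_subset_closure h1)
      (frontier_subset_closure ht)⟩
  classical
  let H : M → M := fun x =>
    if hx : x ∈ X then h ⟨x, hx⟩ else θ (connectedComponentIn Xᶜ x) x
  have hHX : ∀ x : X, H x = h x := fun x => dif_pos x.2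
  have hHU : ∀ U ∈ complComponents X, ∀ x ∈ U, H x = θ U x := by
    intro U hU x hx
    have hxX := subset_compl_of_mem_complComponents hU hx
    have : connectedComponentIn Xᶜ x = U :=
      eq_of_mem_of_mem_complComponents ⟨x, hxX, rfl⟩ hU (mem_connectedComponentIn hxX) hx
    rw [← this]
    exact dif_neg hxX
  have hHm : ∀ U ∈ complComponents X, ∀ x ∈ U, H x ∈ τ U := by
    intro U hU x hx
    rw [hHU U hU x hx]
    exact (hθb U hU).mapsTo hx
  have hHY : ∀ x, x ∉ X → H x ∉ Y := by
    intro x hx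
    obtain ⟨U, hU, hxU⟩ := exists_mem_complComponents hx
    exact subset_compl_of_mem_complComponents (hτ U hU) (hHm U hU x hxU)
  have hinj : Function.Injective H := by
    intro x y hxy
    by_cases hx : x ∈ X <;> by_cases hy : y ∈ X
    · rw [hHX ⟨x, hx⟩, hHX ⟨y, hy⟩] at hxy
      exact congrArg Subtype.val (h.injective (Subtype.ext hxy))
    · exact absurd (hxy ▸ hHX ⟨x, hx⟩ ▸ Subtype.coe_prop _) (hHY y hy)
    · exact absurd (hxy ▸ hHX ⟨y, hy⟩ ▸ Subtype.coe_prop _) (hHY x hx)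
    · obtain ⟨U, hU, hxU⟩ := exists_mem_complComponents hx
      obtain ⟨V, hV, hyV⟩ := exists_mem_complComponents hy
      have hUV : τ U = τ V := eq_of_mem_of_mem_complComponents (hτ U hU) (hτ V hV)
        (hHm U hU x hxU) (hxy ▸ hHm V hV y hyV)
      obtain rfl := hτinj U hU V hV hUV
      rw [hHU U hU x hxU, hHU U hU y hyV] at hxy
      exact (hθb U hU).injOn hxU hyV hxy
  have hsurj : Function.Surjective H := by
    intro y
    by_cases hy : y ∈ Y
    · exact ⟨h.symm ⟨y, hy⟩, by rw [hHX, h.apply_symm_apply]⟩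
    · obtain ⟨V, hV, hyV⟩ := exists_mem_complComponents hy
      obtain ⟨U, hU, rfl⟩ := hτsurj V hV
      obtain ⟨x, hx, hxy⟩ := (hθb U hU).surjOn hyV
      exact ⟨x, by rw [hHU U hU x hx, hxy]⟩
  have hcont : Continuous H := by
    rw [continuous_iff_continuousAt]
    intro x
    by_cases hx : x ∈ X
    · rw [ContinuousAt, hHX ⟨x, hx⟩, _root_.tendsto_nhds]
      intro W hW hxW
      obtain ⟨N, hN, hxN, hNW⟩ := hY.exists_isOpen_closure_subset hW hxW
      obtain ⟨N₁, hN₁, hN₁h⟩ := isOpen_induced_iff.1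
        ((hN.inter hW).preimage (continuous_subtype_val.comp h.continuous))
      have hN₁' : ∀ z : X, (z : M) ∈ N₁ ↔ (h z : M) ∈ N ∩ W := fun z => by
        have := congrArg (z ∈ ·) hN₁h
        simpa using this
      have hxN₁ : x ∈ N₁ := (hN₁' ⟨x, hx⟩).2 ⟨hxN, hxW⟩
      obtain ⟨N₂, hN₂, hxN₂, hN₂'⟩ := hX.exists_isOpen_closure_subset hN₁ hxN₁
      have hloc : ∀ᶠ z in 𝓝 x, ∀ U ∈ complComponents X, x ∈ closure U → z ∈ U → H z ∈ W := by
        by_cases hex : ∃ U ∈ complComponents X, x ∈ closure U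
        · obtain ⟨U, hU, hxU⟩ := hex
          have h1 := hθc U hU x hxU
          rw [ContinuousWithinAt, hθf U hU ⟨x, hx⟩ ((hX.mem_frontier_iff hU).2 ⟨hxU, hx⟩)] at h1
          filter_upwards [eventually_nhdsWithin_iff.1 (h1.eventually (hW.mem_nhds hxW))]
            with z hz V hV hxV hzV
          obtain rfl := hX.eq_of_mem_closure hU hV hxU hxV
          rw [hHU U hU z hzV]
          exact hz (subset_closure hzV)
        · exact Eventually.of_forall fun z U hU hxU => absurd ⟨U, hU, hxU⟩ hex
      filter_upwards [hN₁.mem_nhds hxN₁, hN₂.mem_nhds hxN₂, hloc] with z hz₁ hz₂ hz₃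
      by_cases hzX : z ∈ X
      · rw [mem_preimage, hHX ⟨z, hzX⟩]
        exact ((hN₁' ⟨z, hzX⟩).1 hz₁).2
      · obtain ⟨U, hU, hzU⟩ := exists_mem_complComponents hzX
        by_cases hxU : x ∈ closure U
        · exact hz₃ U hU hxU hzU
        · have hUN₁ := hN₂' U hU hxU ⟨z, subset_closure hzU, hz₂⟩
          obtain ⟨t, ht⟩ := (hX.isConnected_frontier hrank hU).nonempty
          have htN := (hN₁' ⟨t, hX.frontier_subset hU ht⟩).1 (hUN₁ (frontier_subset_closure ht))
          have htτ := (hτf U hU ⟨t, hX.frontier_subset hU ht⟩).1 ht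
          refine hNW (τ U) (hτ U hU) (fun hc => hxU ?_)
            ⟨_, frontier_subset_closure htτ, htN.1⟩ (subset_closure (hHm U hU z hzU))
          exact frontier_subset_closure ((hτf U hU ⟨x, hx⟩).2
            ((hY.mem_frontier_iff (hτ U hU)).2 ⟨hc, Subtype.coe_prop _⟩))
    · obtain ⟨U, hU, hxU⟩ := exists_mem_complComponents hx
      have hUx := (hX.isOpen hU).mem_nhds hxU
      refine (((hθc U hU).mono subset_closure).continuousAt hUx).congr ?_
      filter_upwards [hUx] with z hz
      exact (hHU U hU z hz).symm
  exact ⟨hcont.homeoOfEquivCompactToT2 (f := Equiv.ofBijective H ⟨hinj, hsurj⟩), hHX⟩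

end IsFlatSCarpet

end Extension

/-- Any homeomorphism between two flat S-carpets in the sphere
`Sⁿ` extends to a self-homeomorphism of `Sⁿ`. -/
theorem stmt14 (n : ℕ) (hn : 1 ≤ n)
    (X Y : Set ↥(Metric.sphere (0 : EuclideanSpace ℝ (Fin (n + 1))) 1))
    (hX : IsFlatSCarpet n X) (hY : IsFlatSCarpet n Y)
    (h : ↥X ≃ₜ ↥Y) :
    ∃ H : ↥(Metric.sphere (0 : EuclideanSpace ℝ (Fin (n + 1))) 1) ≃ₜ
          ↥(Metric.sphere (0 : EuclideanSpace ℝ (Fin (n + 1))) 1),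
      ∀ x : ↥X, H (x : ↥(Metric.sphere (0 : EuclideanSpace ℝ (Fin (n + 1))) 1))
        = ((h x : ↥Y) : ↥(Metric.sphere (0 : EuclideanSpace ℝ (Fin (n + 1))) 1)) := by
  rcases hn.eq_or_lt with rfl | hn2
  · exact hX.false_of_one.elim
  · have hrank : ∀ m : ℕ, 1 < m → 1 < Module.rank ℝ (EuclideanSpace ℝ (Fin m)) := fun m hm => by
      rw [← Module.finrank_eq_rank, finrank_euclideanSpace_fin]
      exact_mod_cast hm
    have : PreconnectedSpace (Metric.sphere (0 : EuclideanSpace ℝ (Fin (n + 1))) 1) :=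
      isPreconnected_iff_preconnectedSpace.1 (isPreconnected_sphere (hrank _ (by lia)) 0 1)
    exact hX.exists_homeomorph_extension (hrank n hn2)
      (fun K hK hne ⟨f⟩ => not_isPreconnected_compl_of_sphere_homeomorph_sphere hn2 hK hne f) hY h
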